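/- arXiv:1210.4391 — 2 statements merged into one kernel-verified Lean document; each statement's English description precedes it below -/
import Mathlib

section
/- Fix 1 < p < ∞, let φ be a non-trivial weight on (0, ∞), and set ρ := ρ_{p,φ}. Then the Boyd indices of ρ coincide with its fundamental indices: i_ρ = i̲_ρ and I_ρ = I̲_ρ. -/
open MeasureTheory Set ENNReal Filter

noncomputable section

/-- The interval `I_b = (0, b)` for `b ∈ (0, ∞]`, as a subset of `ℝ`. -/
def IbSet (b : ℝ≥0∞) : Set ℝ := {t : ℝ | 0 < t ∧ ENNReal.ofReal t < b}

/-- `∫₀ᵗ φ`. -/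
def intPhi (φ : ℝ → ℝ≥0∞) (t : ℝ) : ℝ≥0∞ := ∫⁻ s in Ioo (0 : ℝ) t, φ s

/-- `∫ₜᵇ φ(s) s^(-p) ds`. -/
def tailP (b : ℝ≥0∞) (p : ℝ) (φ : ℝ → ℝ≥0∞) (t : ℝ) : ℝ≥0∞ :=
  ∫⁻ s in {s : ℝ | t < s ∧ ENNReal.ofReal s < b}, φ s * ENNReal.ofReal (s ^ (-p))

/-- `∫₀ᵗ φ + tᵖ ∫ₜᵇ φ(s) s^(-p) ds`. -/
def DPhi (b : ℝ≥0∞) (p : ℝ) (φ : ℝ → ℝ≥0∞) (t : ℝ) : ℝ≥0∞ :=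
  intPhi φ t + ENNReal.ofReal (t ^ p) * tailP b p φ t

/-- The Hardy averaging operator `P`. -/
def Pavg (g : ℝ → ℝ≥0∞) (t : ℝ) : ℝ≥0∞ := (ENNReal.ofReal t)⁻¹ * ∫⁻ s in Ioo (0 : ℝ) t, g s

/-- The dual Hardy operator `Q`, `(Qg)(t) = ∫ₜᵇ g(s) s⁻¹ ds`. -/
def Qavg (b : ℝ≥0∞) (g : ℝ → ℝ≥0∞) (t : ℝ) : ℝ≥0∞ :=
  ∫⁻ s in {s : ℝ | t < s ∧ ENNReal.ofReal s < b}, g s * (ENNReal.ofReal s)⁻¹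

/-- The operator `Q_p`, `(Q_p g)(t) = p t^(p-1) ∫ₜᵇ g(s) s^(-p) ds`. -/
def Qp (b : ℝ≥0∞) (p : ℝ) (g : ℝ → ℝ≥0∞) (t : ℝ) : ℝ≥0∞ :=
  ENNReal.ofReal (p * t ^ (p - 1)) *
    ∫⁻ s in {s : ℝ | t < s ∧ ENNReal.ofReal s < b}, g s * ENNReal.ofReal (s ^ (-p))

/-- `(PQ_p)(φ)(t) = t⁻¹ [∫₀ᵗ φ + tᵖ ∫ₜᵇ φ(s) s^(-p) ds]`. -/
def PQp (b : ℝ≥0∞) (p : ℝ) (φ : ℝ → ℝ≥0∞) (t : ℝ) : ℝ≥0∞ :=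
  (ENNReal.ofReal t)⁻¹ * DPhi b p φ t

/-- A weight on `I_b`: a positive, finite, locally integrable function. -/
def IsWeight (b : ℝ≥0∞) (φ : ℝ → ℝ≥0∞) : Prop :=
  Measurable φ ∧ (∀ t ∈ IbSet b, 0 < φ t ∧ φ t < ⊤) ∧
    ∀ a c : ℝ, 0 < a → ENNReal.ofReal c < b → ∫⁻ t in Icc a c, φ t < ⊤

/-- A non-trivial weight on `I_b` for the index `p`. -/
def IsNontrivialWeight (b : ℝ≥0∞) (p : ℝ) (φ : ℝ → ℝ≥0∞) : Prop :=
  IsWeight b φ ∧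
    (b = ⊤ → ∫⁻ t in Ioi (1 : ℝ), φ t * ENNReal.ofReal (t ^ (-p)) < ⊤) ∧
    tailP b p φ 0 = ⊤

/-- The dual weight `ψ(t) = t^(p+p'-1) (∫₀ᵗ φ)(∫ₜᵇ φ(s)s^(-p) ds)/D(t)^(p'+1)`. -/
def dualWeight (b : ℝ≥0∞) (p : ℝ) (φ : ℝ → ℝ≥0∞) (t : ℝ) : ℝ≥0∞ :=
  ENNReal.ofReal (t ^ (p + p / (p - 1) - 1)) * intPhi φ t * tailP b p φ t /
    (DPhi b p φ t) ^ (p / (p - 1) + 1)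

/-- `ψ = (Pφ)(Q_pφ)/[(PQ_p)(φ)]^(p'+1)`. -/
def dualWeight' (b : ℝ≥0∞) (p : ℝ) (φ : ℝ → ℝ≥0∞) (t : ℝ) : ℝ≥0∞ :=
  Pavg φ t * Qp b p φ t / (PQp b p φ t) ^ (p / (p - 1) + 1)

/-- The decreasing rearrangement `f*`. -/
def decRearr {α : Type*} [MeasurableSpace α] (μ : Measure α) (f : α → ℝ) (t : ℝ) : ℝ≥0∞ :=
  sInf {l : ℝ≥0∞ | μ {x | l < (‖f x‖₊ : ℝ≥0∞)} ≤ ENNReal.ofReal t}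

/-- `f**(t) = t⁻¹ ∫₀ᵗ f*`. -/
def avgRearr {α : Type*} [MeasurableSpace α] (μ : Measure α) (f : α → ℝ) (t : ℝ) : ℝ≥0∞ :=
  (ENNReal.ofReal t)⁻¹ * ∫⁻ s in Ioo (0 : ℝ) t, decRearr μ f s

/-- The Lorentz Gamma functional `ρ_{p,φ}(f) = (∫_{I_b} f**(t)^p φ(t) dt)^(1/p)`. -/
def rhoGamma {α : Type*} [MeasurableSpace α] (μ : Measure α) (b : ℝ≥0∞) (p : ℝ)
    (φ : ℝ → ℝ≥0∞) (f : α → ℝ) : ℝ≥0∞ :=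
  (∫⁻ t in IbSet b, (avgRearr μ f t) ^ p * φ t) ^ (1 / p)

/-- The Stieltjes operator `(Sg)(t) = ∫₀^∞ g(s)/(s+t) ds`. -/
def Sop (g : ℝ → ℝ≥0∞) (t : ℝ) : ℝ≥0∞ :=
  ∫⁻ s in Ioi (0 : ℝ), g s / ENNReal.ofReal (s + t)

/-- Lebesgue measure on `(0,∞)`. -/
def mu0 : Measure ℝ := volume.restrict (Ioi (0 : ℝ))

/-- The dilation function `h_ρ`. -/
def hRho (p : ℝ) (φ : ℝ → ℝ≥0∞) (t : ℝ) : ℝ≥0∞ :=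
  ⨆ (f : ℝ → ℝ) (_ : Measurable f) (_ : ∀ x, 0 ≤ f x) (_ : ¬ f =ᵐ[mu0] 0),
    rhoGamma mu0 ⊤ p φ (fun s => f (s / t)) / rhoGamma mu0 ⊤ p φ f

/-- The fundamental function quotient `M_ρ`. -/
def MRho (p : ℝ) (φ : ℝ → ℝ≥0∞) (t : ℝ) : ℝ≥0∞ :=
  ⨆ (a : ℝ) (_ : 0 < a),
    rhoGamma mu0 ⊤ p φ ((Ioo (0 : ℝ) (a * t)).indicator fun _ => (1 : ℝ)) /
      rhoGamma mu0 ⊤ p φ ((Ioo (0 : ℝ) a).indicator fun _ => (1 : ℝ))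

/-- Lower index `sup_{0<t<1} log h(t)/log t`. -/
def lowerIndex (h : ℝ → ℝ≥0∞) : ℝ :=
  sSup ((fun t => Real.log (h t).toReal / Real.log t) '' Ioo (0 : ℝ) 1)

/-- Upper index `inf_{1<t<∞} log h(t)/log t`. -/
def upperIndex (h : ℝ → ℝ≥0∞) : ℝ :=
  sInf ((fun t => Real.log (h t).toReal / Real.log t) '' Ioi (1 : ℝ))

theorem aux_C (p : ℝ) (hp : 1 < p) (c : ℝ) (hc : 0 ≤ c) :
    ∫⁻ r in Ioo (0:ℝ) c, ENNReal.ofReal (p * r ^ (p-1)) = ENNReal.ofReal (c ^ p) := by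
  have h1 : ∫ r in (0:ℝ)..c, p * r ^ (p-1) = c ^ p := by
    rw [intervalIntegral.integral_const_mul, integral_rpow (Or.inl (by linarith))]
    rw [sub_add_cancel, Real.zero_rpow (by linarith)]
    field_simp
    simp
  have h2 : IntervalIntegrable (fun r : ℝ => p * r ^ (p-1)) volume 0 c :=
    (intervalIntegral.intervalIntegrable_rpow' (by linarith)).const_mul p
  rw [← h1, intervalIntegral.integral_of_le hc, ofReal_integral_eq_lintegral_ofReal]
  · exact setLIntegral_congr Ioo_ae_eq_Ioc
  · exact (intervalIntegrable_iff_integrableOn_Ioc_of_le hc).1 h2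
  · filter_upwards [self_mem_ae_restrict measurableSet_Ioc] with r hr
    have := hr.1
    show 0 ≤ _
    positivity

theorem aux_B (p : ℝ) (hp : 1 < p) (s : ℝ) (hs : 0 < s) (E : Set ℝ) (hE : E ⊆ Ioi 0)
    (hl : ∀ r ∈ E, ∀ q, 0 < q → q ≤ r → q ∈ E) :
    ((volume.restrict (Ioo (0:ℝ) s)).withDensity (fun r => ENNReal.ofReal (p * r ^ (p-1)))) E
      = (min (ENNReal.ofReal s) (volume E)) ^ p := by
  have hm : MeasurableSet E := by
    apply Set.OrdConnected.measurableSet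
    constructor
    intro x hx y hy z hz
    exact hl y hy z (lt_of_lt_of_le (hE hx) hz.1) hz.2
  rw [withDensity_apply _ hm, Measure.restrict_restrict hm]
  rcases E.eq_empty_or_nonempty with rfl | hne
  · simp [show 0 < p by linarith]
  by_cases hb : BddAbove E
  · set c := sSup E with hc
    have h1 : Ioo 0 c ⊆ E := by
      intro x hx
      obtain ⟨y, hy, hxy⟩ := exists_lt_of_lt_csSup hne hx.2
      exact hl y hy x hx.1 hxy.le
    have h2 : E ⊆ Ioc 0 c := fun x hx => ⟨hE hx, le_csSup hb hx⟩
    have hc0 : 0 ≤ c := by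
      obtain ⟨x, hx⟩ := hne
      exact (h2 hx).1.le.trans (h2 hx).2
    have h3 : E =ᵐ[volume] Ioo 0 c := by
      apply Filter.EventuallyLE.antisymm
      · exact (LE.le.eventuallyLE h2).trans Ioo_ae_eq_Ioc.symm.le
      · exact LE.le.eventuallyLE h1
    have h4 : (E ∩ Ioo 0 s : Set ℝ) =ᵐ[volume] Ioo 0 (min c s) := by
      have := h3.inter (Filter.EventuallyEq.refl (ae volume) (Ioo (0:ℝ) s))
      rwa [Ioo_inter_Ioo, max_self] at this
    rw [setLIntegral_congr h4, aux_C p hp _ (le_min hc0 hs.le), measure_congr h3, Real.volume_Ioo,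
      sub_zero, ← ENNReal.ofReal_min, ENNReal.ofReal_rpow_of_nonneg (le_min hs.le hc0) (by linarith),
      min_comm]
  · have h1 : E = Ioi 0 := by
      apply Subset.antisymm hE
      intro x hx
      rw [not_bddAbove_iff] at hb
      obtain ⟨y, hy, hxy⟩ := hb x
      exact hl y hy x hx hxy.le
    subst h1
    have h2 : Ioi (0:ℝ) ∩ Ioo 0 s = Ioo 0 s := by
      apply inter_eq_right.2; intro x hx; exact hx.1
    rw [h2, aux_C p hp _ hs.le, Real.volume_Ioi, min_top_right,
      ENNReal.ofReal_rpow_of_nonneg hs.le (by linarith)]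

theorem aux_FTC (p : ℝ) (hp : 1 < p) (v : ℝ → ℝ) (hv : AntitoneOn v (Ioi 0))
    (hv0 : ∀ x, 0 ≤ v x) (hm : Measurable v)
    (hi : ∀ s, 0 < s → IntegrableOn v (Ioc 0 s)) (s : ℝ) (hs : 0 < s) :
    ENNReal.ofReal ((∫ r in (0:ℝ)..s, v r) ^ p) =
      ∫⁻ r in Ioo 0 s, ENNReal.ofReal (p * (∫ q in (0:ℝ)..r, v q) ^ (p-1) * v r) := by
  set F : ℝ → ℝ := fun x => ∫ r in (0:ℝ)..x, v r with hF
  have hii : ∀ s, 0 < s → IntervalIntegrable v volume 0 s := fun s hs =>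
    (intervalIntegrable_iff_integrableOn_Ioc_of_le hs.le).2 (hi s hs)
  have hFc : ContinuousOn F (Icc 0 s) :=
    intervalIntegral.continuousOn_primitive_interval
      (by rw [uIcc_of_le hs.le, integrableOn_Icc_iff_integrableOn_Ioc]; exact hi s hs)
      |>.mono (by rw [uIcc_of_le hs.le])
  have hF0 : ∀ x, 0 ≤ x → 0 ≤ F x := fun x hx =>
    intervalIntegral.integral_nonneg hx (fun r _ => hv0 r)
  set S := {x ∈ Ioi (0:ℝ) | ¬ContinuousWithinAt v (Ioi 0) x} with hS
  have hSc : S.Countable := hv.countable_not_continuousWithinAt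
  have hGc : ContinuousOn (fun x => F x ^ (p-1)) (Icc 0 s) :=
    hFc.rpow_const (fun x hx => Or.inr (by linarith))
  have hint : IntervalIntegrable (fun r => p * F r ^ (p-1) * v r) volume 0 s := by
    apply (hii s hs).continuousOn_mul
    rw [uIcc_of_le hs.le]
    exact continuousOn_const.mul hGc
  have key := integral_eq_of_hasDerivAt_off_countable_of_le (fun x => F x ^ p)
    (fun r => p * F r ^ (p-1) * v r) hs.le hSc
    (hFc.rpow_const (fun x hx => Or.inr (by linarith)))
    (by
      rintro x ⟨hx, hxS⟩
      have hca : ContinuousAt v x := by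
        have : ContinuousWithinAt v (Ioi 0) x := by
          by_contra hh
          exact hxS ⟨hx.1, hh⟩
        exact this.continuousAt (Ioi_mem_nhds hx.1)
      have hd : HasDerivAt F (v x) x :=
        intervalIntegral.integral_hasDerivAt_right (hii x hx.1)
          hm.stronglyMeasurable.stronglyMeasurableAtFilter hca
      have := hd.rpow_const (p := p) (Or.inr hp.le)
      exact this.congr_deriv (by ring)) hint
  have hz : F 0 = 0 := by simp [hF]
  simp only [hz, Real.zero_rpow (show p ≠ 0 by linarith), sub_zero] at key
  show ENNReal.ofReal (F s ^ p) = _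
  rw [← key, intervalIntegral.integral_of_le hs.le, ofReal_integral_eq_lintegral_ofReal]
  · exact (setLIntegral_congr Ioo_ae_eq_Ioc).symm
  · exact (intervalIntegrable_iff_integrableOn_Ioc_of_le hs.le).1 hint
  · filter_upwards [self_mem_ae_restrict measurableSet_Ioc] with r hr
    have := hF0 r hr.1.le
    have := hv0 r
    show 0 ≤ _
    positivity

theorem aux_layer (p : ℝ) (hp : 1 < p) (v : ℝ → ℝ) (hv : AntitoneOn v (Ioi 0))
    (hv0 : ∀ x, 0 ≤ v x) (hm : Measurable v)
    (hi : ∀ s, 0 < s → IntegrableOn v (Ioc 0 s)) :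
    ∃ N : ℝ → ℝ≥0∞, Measurable N ∧ ∀ s, 0 < s →
      ENNReal.ofReal ((∫ r in (0:ℝ)..s, v r) ^ p) =
        ∫⁻ l in Ioi (0:ℝ), (min (ENNReal.ofReal s) (N l)) ^ p := by
  set F : ℝ → ℝ := fun x => ∫ r in (0:ℝ)..x, v r with hF
  have hii : ∀ s, 0 < s → IntervalIntegrable v volume 0 s := fun s hs =>
    (intervalIntegrable_iff_integrableOn_Ioc_of_le hs.le).2 (hi s hs)
  have hF0 : ∀ x, 0 ≤ x → 0 ≤ F x := fun x hx =>
    intervalIntegral.integral_nonneg hx (fun r _ => hv0 r)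
  have hA : AntitoneOn (fun r => F r / r) (Ioi 0) := by
    intro r hr s hs hrs
    have hr' : 0 < r := hr
    have hs' : 0 < s := hs
    have hir : IntervalIntegrable v volume r s := (hii r hr').symm.trans (hii s hs')
    have e1 : F s = F r + ∫ x in r..s, v x :=
      (intervalIntegral.integral_add_adjacent_intervals (hii r hr') hir).symm
    have e2 : ∫ x in r..s, v x ≤ (s - r) * v r := by
      have := intervalIntegral.integral_mono_on hrs hir
        (intervalIntegrable_const (c := v r)) (fun x hx => hv hr (lt_of_lt_of_le hr' hx.1) hx.1)
      simpa using this
    have e3 : r * v r ≤ F r := by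
      have := intervalIntegral.integral_mono_on_of_le_Ioo hr'.le
        (intervalIntegrable_const (c := v r)) (hii r hr') (fun x hx => hv hx.1 hr hx.2.le)
      simpa using this
    show F s / s ≤ F r / r
    rw [div_le_div_iff₀ hs' hr', e1]
    nlinarith [mul_le_mul_of_nonneg_left e2 hr'.le, mul_le_mul_of_nonneg_left e3 (sub_nonneg.2 hrs)]
  set g : ℝ → ℝ := fun r => v r * (F r / r) ^ (p-1) with hg
  have hgA : AntitoneOn g (Ioi 0) := by
    intro r hr s hs hrs
    have hr' : 0 < r := hr
    have hs' : 0 < s := hs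
    have := hF0 s hs'.le
    exact mul_le_mul (hv hr hs hrs) (Real.rpow_le_rpow (by positivity) (hA hr hs hrs) (by linarith))
      (by positivity) (hv0 r)
  set E : ℝ → Set ℝ := fun l => {r | 0 < r ∧ l < g r} with hE
  refine ⟨fun l => volume (E l), ?_, ?_⟩
  · apply Antitone.measurable
    intro a b hab
    apply measure_mono
    intro r hr
    exact ⟨hr.1, hab.trans_lt hr.2⟩
  intro s hs
  have hgm : AEMeasurable g (volume.restrict (Ioo 0 s)) :=
    aemeasurable_restrict_of_antitoneOn measurableSet_Ioo
      (hgA.mono (fun x hx => hx.1))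
  have hdm : Measurable (fun r : ℝ => ENNReal.ofReal (p * r ^ (p-1))) := by fun_prop
  have hgm' := hgm.mono_ac (withDensity_absolutelyContinuous (volume.restrict (Ioo 0 s))
    (fun r : ℝ => ENNReal.ofReal (p * r ^ (p-1))))
  have hae : ∀ᵐ r ∂((volume.restrict (Ioo 0 s)).withDensity
    (fun r : ℝ => ENNReal.ofReal (p * r ^ (p-1)))), r ∈ Ioo 0 s :=
    (withDensity_absolutelyContinuous _ _) (self_mem_ae_restrict measurableSet_Ioo)
  have hlc := lintegral_eq_lintegral_meas_lt ((volume.restrict (Ioo 0 s)).withDensity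
    (fun r : ℝ => ENNReal.ofReal (p * r ^ (p-1)))) (f := g) (by
      filter_upwards [hae] with r hr
      have := hF0 r hr.1.le
      have := hv0 r
      have := hr.1
      show 0 ≤ g r
      simp only [hg]
      positivity) hgm'
  show ENNReal.ofReal (F s ^ p) = _
  rw [aux_FTC p hp v hv hv0 hm hi s hs]
  rw [lintegral_withDensity_eq_lintegral_mul₀ hdm.aemeasurable hgm.ennreal_ofReal] at hlc
  calc _ = ∫⁻ r in Ioo 0 s, ((fun r : ℝ => ENNReal.ofReal (p * r ^ (p-1))) *
          fun r => ENNReal.ofReal (g r)) r := by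
        apply setLIntegral_congr_fun measurableSet_Ioo
        intro r hr
        have hr' : 0 < r := hr.1
        show ENNReal.ofReal (p * F r ^ (p-1) * v r) = ENNReal.ofReal _ * ENNReal.ofReal _
        rw [← ENNReal.ofReal_mul (by positivity)]
        congr 1
        simp only [hg]
        rw [Real.div_rpow (hF0 r hr'.le) hr'.le]
        field_simp
    _ = _ := by
        rw [hlc]
        apply lintegral_congr
        intro l
        rw [← aux_B p hp s hs (E l) (fun r hr => hr.1)
          (fun r hr q hq hqr => ⟨hq, hr.2.trans_le (hgA hq hr.1 hqr)⟩)]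
        apply measure_congr
        filter_upwards [hae] with r hr
        apply propext
        exact ⟨fun h => ⟨hr.1, h⟩, fun h => h.2⟩

theorem aux_main (p : ℝ) (hp : 1 < p) (u : ℝ → ℝ≥0∞) (hu : Antitone u)
    (hi : ∀ s, 0 < s → ∫⁻ r in Ioo 0 s, u r < ⊤) :
    ∃ N : ℝ → ℝ≥0∞, Measurable N ∧ ∀ s, 0 < s →
      ((ENNReal.ofReal s)⁻¹ * ∫⁻ r in Ioo 0 s, u r) ^ p =
        ∫⁻ l in Ioi (0:ℝ), (min 1 (N l / ENNReal.ofReal s)) ^ p := by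
  have hum : Measurable u := hu.measurable
  have hut : ∀ s, 0 < s → u s < ⊤ := by
    intro s hs
    by_contra h
    rw [not_lt, top_le_iff] at h
    have h2 : ∫⁻ r in Ioo 0 s, (⊤:ℝ≥0∞) ≤ ∫⁻ r in Ioo 0 s, u r := by
      apply setLIntegral_mono hum
      intro r hr
      rw [← h]; exact hu hr.2.le
    rw [setLIntegral_const, Real.volume_Ioo, ENNReal.top_mul (by simpa using hs)] at h2
    exact absurd (h2.trans_lt (hi s hs)) (lt_irrefl _)
  have heq : ∀ s, 0 < s → ENNReal.ofReal (∫ r in (0:ℝ)..s, (u r).toReal) =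
      ∫⁻ r in Ioo 0 s, u r := by
    intro s hs
    rw [intervalIntegral.integral_of_le hs.le, integral_toReal hum.aemeasurable, ENNReal.ofReal_toReal]
    · exact (setLIntegral_congr Ioo_ae_eq_Ioc).symm
    · rw [← setLIntegral_congr Ioo_ae_eq_Ioc]; exact (hi s hs).ne
    · filter_upwards [self_mem_ae_restrict measurableSet_Ioc] with r hr using hut r hr.1
  obtain ⟨N, hN, h⟩ := aux_layer p hp (fun r => (u r).toReal)
    (fun r hr s hs hrs => ENNReal.toReal_mono (hut r hr).ne (hu hrs))
    (fun _ => ENNReal.toReal_nonneg) hum.ennreal_toReal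
    (fun s hs => integrable_toReal_of_lintegral_ne_top hum.aemeasurable
      (by rw [← setLIntegral_congr Ioo_ae_eq_Ioc]; exact (hi s hs).ne))
  refine ⟨N, hN, fun s hs => ?_⟩
  have hp0 : 0 ≤ p := by linarith
  have hs0 : ENNReal.ofReal s ≠ 0 := by simpa using hs
  rw [← heq s hs, ENNReal.mul_rpow_of_nonneg _ _ hp0, ENNReal.ofReal_rpow_of_nonneg
    (intervalIntegral.integral_nonneg hs.le (fun r _ => ENNReal.toReal_nonneg)) hp0, h s hs,
    ← lintegral_const_mul _ (by fun_prop)]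
  apply lintegral_congr
  intro l
  rw [← ENNReal.mul_rpow_of_nonneg _ _ hp0]
  congr 1
  rw [mul_min, ENNReal.inv_mul_cancel hs0 ENNReal.ofReal_ne_top, mul_comm, ENNReal.div_eq_inv_mul,
    mul_comm]

/-- extended fundamental function (p-th power) -/
def Dt (p : ℝ) (φ : ℝ → ℝ≥0∞) (N : ℝ≥0∞) : ℝ≥0∞ :=
  ∫⁻ s in Ioi (0:ℝ), (min 1 (N / ENNReal.ofReal s)) ^ p * φ s

theorem IbSet_top : IbSet ⊤ = Ioi (0:ℝ) := by
  ext t; simp [IbSet]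

theorem decRearr_antitone (f : ℝ → ℝ) : Antitone (decRearr mu0 f) := by
  intro s t hst
  apply sInf_le_sInf
  intro l hl
  exact le_trans hl (ENNReal.ofReal_le_ofReal hst)

theorem decRearr_dil (f : ℝ → ℝ) (t : ℝ) (ht : 0 < t) (s : ℝ) :
    decRearr mu0 (fun x => f (x / t)) s = decRearr mu0 f (s / t) := by
  unfold decRearr
  congr 1
  ext l
  have h0 : ∀ A : Set ℝ, mu0 A = volume (A ∩ Ioi 0) := fun A => by
    unfold mu0
    rw [Measure.restrict_apply' measurableSet_Ioi]
  have e : ({x | l < (‖f (x / t)‖₊ : ℝ≥0∞)} ∩ Ioi 0 : Set ℝ) =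
      (t⁻¹ * ·) ⁻¹' ({x | l < (‖f x‖₊ : ℝ≥0∞)} ∩ Ioi 0) := by
    ext x
    simp only [mem_inter_iff, mem_preimage, mem_Ioi]
    have : t⁻¹ * x = x / t := by field_simp
    rw [this]
    simp [ht, div_pos_iff_of_pos_right]
  show mu0 _ ≤ _ ↔ mu0 _ ≤ _
  rw [h0, h0, e, Real.volume_preimage_mul_left (by positivity), inv_inv, abs_of_pos ht,
    ENNReal.ofReal_div_of_pos ht, ENNReal.le_div_iff_mul_le (by simp [ht]) (by simp), mul_comm]

theorem avgRearr_dil (f : ℝ → ℝ) (t : ℝ) (ht : 0 < t) (s : ℝ) (hs : 0 < s) :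
    avgRearr mu0 (fun x => f (x / t)) s = avgRearr mu0 f (s / t) := by
  unfold avgRearr
  simp_rw [decRearr_dil f t ht]
  have hm : Measurable (decRearr mu0 f) := (decRearr_antitone f).measurable
  have h1 : ∫⁻ r in Ioo 0 s, decRearr mu0 f (r / t) =
      ENNReal.ofReal t * ∫⁻ r in Ioo 0 (s/t), decRearr mu0 f r := by
    have e := lintegral_map (μ := volume) (f := (Ioo 0 (s/t)).indicator (decRearr mu0 f))
      (g := fun x : ℝ => t⁻¹ * x) (hm.indicator measurableSet_Ioo) (by fun_prop)
    rw [Real.map_volume_mul_left (by positivity), inv_inv, abs_of_pos ht, lintegral_smul_measure,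
      lintegral_indicator measurableSet_Ioo, smul_eq_mul] at e
    rw [e, ← lintegral_indicator measurableSet_Ioo]
    apply lintegral_congr
    intro x
    have : t⁻¹ * x = x / t := by field_simp
    rw [this]
    simp only [indicator, mem_Ioo, div_lt_div_iff_of_pos_right ht, div_pos_iff_of_pos_right ht]
  rw [h1, ENNReal.ofReal_div_of_pos ht, ENNReal.inv_div (by simp) (by simp [ht]), ← mul_assoc,
    ENNReal.div_eq_inv_mul]

theorem avgRearr_ind (a : ℝ) (ha : 0 < a) (s : ℝ) (hs : 0 < s) :
    avgRearr mu0 ((Ioo (0 : ℝ) a).indicator fun _ => (1 : ℝ)) s =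
      min 1 (ENNReal.ofReal a / ENNReal.ofReal s) := by
  have hset : ∀ l : ℝ≥0∞, mu0 {x | l < (‖(Ioo (0 : ℝ) a).indicator (fun _ => (1 : ℝ)) x‖₊ : ℝ≥0∞)}
      = if l < 1 then ENNReal.ofReal a else 0 := by
    intro l
    split_ifs with hl
    · have : {x | l < (‖(Ioo (0 : ℝ) a).indicator (fun _ => (1 : ℝ)) x‖₊ : ℝ≥0∞)} = Ioo 0 a := by
        ext x
        by_cases hx : x ∈ Ioo 0 a
        · simp [hx, hl, -mem_Ioo]
        · simp [hx, -mem_Ioo]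
      rw [this, mu0, Measure.restrict_apply' measurableSet_Ioi, inter_eq_left.2 (fun x hx => hx.1)]
      simp
    · have : {x | l < (‖(Ioo (0 : ℝ) a).indicator (fun _ => (1 : ℝ)) x‖₊ : ℝ≥0∞)} = ∅ := by
        ext x
        by_cases hx : x ∈ Ioo 0 a
        · simpa [hx, -mem_Ioo] using hl
        · simp [hx, -mem_Ioo]
      rw [this, measure_empty]
  have hd : ∀ r, decRearr mu0 ((Ioo (0 : ℝ) a).indicator fun _ => (1 : ℝ)) r =
      (Iio a).indicator (fun _ => (1:ℝ≥0∞)) r := by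
    intro r
    unfold decRearr
    simp_rw [hset]
    by_cases hr : r < a
    · rw [indicator_of_mem (show r ∈ Iio a from hr)]
      apply le_antisymm
      · apply sInf_le
        simp
      · apply le_sInf
        intro l hl
        by_contra hc
        rw [not_le] at hc
        have hl' : (if l < 1 then ENNReal.ofReal a else 0) ≤ ENNReal.ofReal r := hl
        rw [if_pos hc, ENNReal.ofReal_le_ofReal_iff'] at hl'
        rcases hl' with h | h <;> linarith
    · rw [indicator_of_notMem (show r ∉ Iio a from hr)]
      apply le_antisymm _ bot_le
      apply sInf_le
      simp only [mem_ofPred_eq]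
      simpa using ENNReal.ofReal_le_ofReal (not_lt.1 hr)
  unfold avgRearr
  simp_rw [hd]
  rw [lintegral_indicator measurableSet_Iio, lintegral_one, Measure.restrict_restrict measurableSet_Iio,
    Measure.restrict_apply_univ]
  have : Iio a ∩ Ioo 0 s = Ioo 0 (min s a) := by
    ext x; simp; tauto
  rw [this, Real.volume_Ioo, sub_zero, ENNReal.ofReal_min, mul_min,
    ENNReal.inv_mul_cancel (by simpa using hs) ENNReal.ofReal_ne_top, ENNReal.div_eq_inv_mul]

theorem rho_ind (p : ℝ) (φ : ℝ → ℝ≥0∞) (a : ℝ) (ha : 0 < a) :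
    rhoGamma mu0 ⊤ p φ ((Ioo (0 : ℝ) a).indicator fun _ => (1 : ℝ)) =
      Dt p φ (ENNReal.ofReal a) ^ (1/p) := by
  unfold rhoGamma Dt
  rw [IbSet_top]
  congr 1
  apply setLIntegral_congr_fun measurableSet_Ioi
  intro s hs
  simp only [avgRearr_ind a ha s hs]

theorem Dt_pos (p : ℝ) (hp : 1 < p) (φ : ℝ → ℝ≥0∞) (hm : Measurable φ)
    (h0 : ∀ s, 0 < s → 0 < φ s) (a : ℝ) (ha : 0 < a) : Dt p φ (ENNReal.ofReal a) ≠ 0 := by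
  unfold Dt
  intro h
  rw [lintegral_eq_zero_iff (by fun_prop)] at h
  have h2 : ∀ᵐ s ∂(volume.restrict (Ioi (0:ℝ))), False := by
    filter_upwards [h, self_mem_ae_restrict measurableSet_Ioi] with s hs hs0
    have h1 := (h0 s hs0).ne'
    have h3 : min 1 (ENNReal.ofReal a / ENNReal.ofReal s) ≠ 0 := by
      simp [ha]
    have h4 : (min 1 (ENNReal.ofReal a / ENNReal.ofReal s)) ^ p ≠ 0 := by
      intro h5
      rw [ENNReal.rpow_eq_zero_iff_of_pos (by linarith)] at h5
      exact h3 h5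
    exact mul_ne_zero h4 h1 hs
  rw [Filter.eventually_false_iff_eq_bot, ae_eq_bot, Measure.restrict_eq_zero] at h2
  simp at h2

theorem Dt_le (p : ℝ) (hp : 1 < p) (φ : ℝ → ℝ≥0∞) (hm : Measurable φ)
    (h0 : ∀ s, 0 < s → 0 < φ s) (t : ℝ) (ht : 0 < t) (N : ℝ≥0∞) (hN : Dt p φ N < ⊤) :
    Dt p φ (ENNReal.ofReal t * N) ≤ MRho p φ t ^ p * Dt p φ N := by
  have hp0 : 0 < p := by linarith
  have key : ∀ a, 0 < a → Dt p φ (ENNReal.ofReal a) < ⊤ →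
      Dt p φ (ENNReal.ofReal (a * t)) ≤ MRho p φ t ^ p * Dt p φ (ENNReal.ofReal a) := by
    intro a ha hfin
    have h1 : Dt p φ (ENNReal.ofReal (a*t)) ^ (1/p) / Dt p φ (ENNReal.ofReal a) ^ (1/p)
        ≤ MRho p φ t := by
      rw [← rho_ind p φ a ha, ← rho_ind p φ (a*t) (by positivity)]
      exact le_iSup₂ (f := fun (a : ℝ) (_ : 0 < a) =>
        rhoGamma mu0 ⊤ p φ ((Ioo (0 : ℝ) (a * t)).indicator fun _ => (1 : ℝ)) /
        rhoGamma mu0 ⊤ p φ ((Ioo (0 : ℝ) a).indicator fun _ => (1 : ℝ))) a ha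
    have hpos := Dt_pos p hp φ hm h0 a ha
    rw [ENNReal.div_le_iff (by simp [hpos, hfin.ne, hp0])
      (by simp [hpos, hfin.ne, hp0, hp0.le])] at h1
    have h2 := ENNReal.rpow_le_rpow h1 hp0.le
    rwa [ENNReal.mul_rpow_of_nonneg _ _ hp0.le, ← ENNReal.rpow_mul, ← ENNReal.rpow_mul,
      one_div_mul_cancel hp0.ne', ENNReal.rpow_one, ENNReal.rpow_one] at h2
  have mono : ∀ a b, a ≤ b → Dt p φ a ≤ Dt p φ b := by
    intro a b hab
    unfold Dt
    gcongr
  rcases eq_or_ne N ⊤ with rfl | hNt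
  · rw [ENNReal.mul_top (by simpa using ht)]
    have hD : Dt p φ ⊤ = ∫⁻ s in Ioi (0:ℝ), φ s := by
      unfold Dt
      apply lintegral_congr
      intro s
      simp [ENNReal.top_div]
    have hU : Ioi (0:ℝ) = ⋃ n : ℕ, Ioo 0 (((n:ℝ)+1) * t) := by
      ext x
      simp only [mem_Ioi, mem_iUnion, mem_Ioo]
      constructor
      · intro hx
        obtain ⟨n, hn⟩ := exists_nat_gt (x / t)
        refine ⟨n, hx, ?_⟩
        rw [div_lt_iff₀ ht] at hn
        nlinarith
      · rintro ⟨n, h, _⟩; exact h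
    rw [hD]
    conv_lhs => rw [hU]
    rw [setLIntegral_iUnion_of_directed]
    · apply iSup_le
      intro n
      calc ∫⁻ s in Ioo 0 (((n:ℝ)+1) * t), φ s
          = ∫⁻ s in Ioo 0 (((n:ℝ)+1) * t),
              (min 1 (ENNReal.ofReal (((n:ℝ)+1) * t) / ENNReal.ofReal s)) ^ p * φ s := by
            apply setLIntegral_congr_fun measurableSet_Ioo
            intro s hs
            have : 1 ≤ ENNReal.ofReal (((n:ℝ)+1) * t) / ENNReal.ofReal s := by
              rw [ENNReal.le_div_iff_mul_le (by simp [hs.1]) (by simp), one_mul]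
              exact ENNReal.ofReal_le_ofReal hs.2.le
            simp [min_eq_left this]
        _ ≤ Dt p φ (ENNReal.ofReal (((n:ℝ)+1) * t)) :=
            lintegral_mono_set (fun x hx => hx.1)
        _ ≤ MRho p φ t ^ p * Dt p φ (ENNReal.ofReal ((n:ℝ)+1)) :=
            key _ (by positivity) ((mono _ _ le_top).trans_lt hN)
        _ ≤ MRho p φ t ^ p * Dt p φ ⊤ := by gcongr; exact mono _ _ le_top
        _ = _ := by rw [hD]
    · apply Monotone.directed_le
      intro a b hab
      apply Ioo_subset_Ioo_right
      have : (a:ℝ) ≤ b := by exact_mod_cast hab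
      nlinarith
  · rcases eq_or_ne N 0 with rfl | hN0
    · simp [Dt, hp0]
    · have e : N = ENNReal.ofReal N.toReal := (ENNReal.ofReal_toReal hNt).symm
      have hpos : 0 < N.toReal := ENNReal.toReal_pos hN0 hNt
      rw [e] at hN ⊢
      rw [← ENNReal.ofReal_mul ht.le, mul_comm t]
      exact key _ hpos hN

theorem rho_dil_le (p : ℝ) (hp : 1 < p) (φ : ℝ → ℝ≥0∞) (hm : Measurable φ)
    (h0 : ∀ s, 0 < s → 0 < φ s) (t : ℝ) (ht : 0 < t) (f : ℝ → ℝ)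
    (hf : rhoGamma mu0 ⊤ p φ f < ⊤) :
    rhoGamma mu0 ⊤ p φ (fun s => f (s / t)) ≤ MRho p φ t * rhoGamma mu0 ⊤ p φ f := by
  have hp0 : 0 < p := by linarith
  have hum := (decRearr_antitone f).measurable
  unfold rhoGamma at hf ⊢
  rw [IbSet_top] at hf ⊢
  have hfin : ∫⁻ s in Ioi 0, avgRearr mu0 f s ^ p * φ s < ⊤ := by
    rwa [ENNReal.rpow_lt_top_iff_of_pos (by positivity)] at hf
  -- local integrability
  have hi : ∀ s, 0 < s → ∫⁻ r in Ioo 0 s, decRearr mu0 f r < ⊤ := by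
    intro s hs
    by_contra hc
    rw [not_lt, top_le_iff] at hc
    have hall : ∀ x ∈ Ioi s, avgRearr mu0 f x ^ p * φ x = ⊤ := by
      intro x hx
      have hx0 : 0 < x := hs.trans hx
      have h1 : ∫⁻ r in Ioo 0 x, decRearr mu0 f r = ⊤ := by
        rw [← top_le_iff, ← hc]
        exact lintegral_mono_set (Ioo_subset_Ioo_right (le_of_lt hx))
      have h2 : avgRearr mu0 f x = ⊤ := by
        unfold avgRearr
        rw [h1, ENNReal.mul_top (by simp)]
      rw [h2, ENNReal.top_rpow_of_pos hp0, ENNReal.top_mul (h0 x hx0).ne']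
    have h3 : ∫⁻ x in Ioi s, (⊤:ℝ≥0∞) ≤ ∫⁻ s in Ioi 0, avgRearr mu0 f s ^ p * φ s := by
      rw [← setLIntegral_congr_fun measurableSet_Ioi hall]
      exact lintegral_mono_set (Ioi_subset_Ioi hs.le)
    rw [setLIntegral_const, Real.volume_Ioi, ENNReal.top_mul_top] at h3
    exact absurd (h3.trans_lt hfin) (lt_irrefl _)
  obtain ⟨N, hN, hrep⟩ := aux_main p hp _ (decRearr_antitone f) hi
  have hA : ∀ c : ℝ≥0∞, ∫⁻ s in Ioi (0:ℝ), (∫⁻ l in Ioi (0:ℝ),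
      (min 1 (c * N l / ENNReal.ofReal s)) ^ p) * φ s = ∫⁻ l in Ioi (0:ℝ), Dt p φ (c * N l) := by
    intro c
    unfold Dt
    rw [lintegral_lintegral_swap]
    · apply lintegral_congr
      intro s
      rw [lintegral_mul_const _ (by fun_prop)]
    · apply Measurable.aemeasurable
      fun_prop
  have e1 : ∫⁻ s in Ioi 0, avgRearr mu0 f s ^ p * φ s = ∫⁻ l in Ioi (0:ℝ), Dt p φ (N l) := by
    have := hA 1
    simp only [one_mul] at this
    rw [← this]
    apply setLIntegral_congr_fun measurableSet_Ioi
    intro s hs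
    show avgRearr mu0 f s ^ p * φ s = _
    beta_reduce
    rw [← hrep s hs]
    rfl
  have e2 : ∫⁻ s in Ioi 0, avgRearr mu0 (fun s => f (s / t)) s ^ p * φ s =
      ∫⁻ l in Ioi (0:ℝ), Dt p φ (ENNReal.ofReal t * N l) := by
    rw [← hA]
    apply setLIntegral_congr_fun measurableSet_Ioi
    intro s hs
    have hs' : 0 < s := hs
    show avgRearr mu0 (fun s => f (s / t)) s ^ p * φ s = _
    rw [avgRearr_dil f t ht s hs]
    have := hrep (s/t) (by positivity)
    unfold avgRearr
    rw [this]
    congr 1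
    apply lintegral_congr
    intro l
    congr 2
    rw [ENNReal.ofReal_div_of_pos ht, ENNReal.div_eq_inv_mul, ENNReal.inv_div (by simp) (by simp [ht]),
      ENNReal.div_eq_inv_mul, ENNReal.div_eq_inv_mul, mul_assoc]
  have hDm : Measurable (fun l => Dt p φ (N l)) := by
    unfold Dt
    apply Measurable.lintegral_prod_right'
      (f := fun z : ℝ × ℝ => (min 1 (N z.1 / ENNReal.ofReal z.2)) ^ p * φ z.2)
    fun_prop
  have e3 : ∫⁻ l in Ioi (0:ℝ), Dt p φ (ENNReal.ofReal t * N l) ≤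
      MRho p φ t ^ p * ∫⁻ l in Ioi (0:ℝ), Dt p φ (N l) := by
    rw [← lintegral_const_mul _ hDm]
    apply lintegral_mono_ae
    rw [e1] at hfin
    filter_upwards [ae_lt_top hDm hfin.ne] with l hl
    exact Dt_le p hp φ hm h0 t ht (N l) hl
  rw [e1, e2]
  calc _ ≤ (MRho p φ t ^ p * ∫⁻ l in Ioi (0:ℝ), Dt p φ (N l)) ^ (1/p) :=
        ENNReal.rpow_le_rpow e3 (by positivity)
    _ = _ := by
        rw [ENNReal.mul_rpow_of_nonneg _ _ (by positivity), ← ENNReal.rpow_mul,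
          mul_one_div_cancel hp0.ne', ENNReal.rpow_one]

theorem hRho_eq (p : ℝ) (hp : 1 < p) (φ : ℝ → ℝ≥0∞) (hφ : IsNontrivialWeight ⊤ p φ)
    (t : ℝ) (ht : 0 < t) : hRho p φ t = MRho p φ t := by
  have hm : Measurable φ := hφ.1.1
  have h0 : ∀ s, 0 < s → 0 < φ s := fun s hs => (hφ.1.2.1 s (by rw [IbSet_top]; exact hs)).1
  apply le_antisymm
  · unfold hRho
    refine iSup_le fun f => iSup_le fun _ => iSup_le fun _ => iSup_le fun _ => ?_
    rcases eq_or_ne (rhoGamma mu0 ⊤ p φ f) ⊤ with h | h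
    · rw [h, ENNReal.div_top]; exact bot_le
    · exact ENNReal.div_le_of_le_mul (rho_dil_le p hp φ hm h0 t ht f (lt_top_iff_ne_top.2 h))
  · unfold MRho
    refine iSup₂_le fun a ha => ?_
    set f : ℝ → ℝ := (Ioo (0 : ℝ) a).indicator fun _ => (1 : ℝ) with hf
    have e : (Ioo (0 : ℝ) (a * t)).indicator (fun _ => (1 : ℝ)) = fun s => f (s / t) := by
      funext s
      simp only [hf, indicator, mem_Ioo, div_pos_iff_of_pos_right ht, div_lt_iff₀ ht]
    rw [e]
    unfold hRho
    have h1 : Measurable f := measurable_const.indicator measurableSet_Ioo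
    have h2 : ∀ x, 0 ≤ f x := fun x => indicator_nonneg (fun _ _ => zero_le_one) x
    have h3 : ¬ f =ᵐ[mu0] 0 := by
      intro h
      have h4 : mu0 (Ioo 0 a) = 0 := by
        apply measure_mono_null _ h
        intro x hx
        simpa [hf] using hx
      rw [mu0, Measure.restrict_apply' measurableSet_Ioi,
        inter_eq_left.2 (fun x hx => hx.1)] at h4
      simp at h4
      linarith
    exact le_iSup_of_le f (le_iSup_of_le h1 (le_iSup_of_le h2 (le_iSup_of_le h3 le_rfl)))

theorem statement15 (p : ℝ) (hp : 1 < p) (φ : ℝ → ℝ≥0∞)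
    (hφ : IsNontrivialWeight ⊤ p φ) :
    lowerIndex (hRho p φ) = lowerIndex (MRho p φ) ∧
      upperIndex (hRho p φ) = upperIndex (MRho p φ) := by
  have h := hRho_eq p hp φ hφ
  unfold lowerIndex upperIndex
  constructor
  · congr 1
    apply image_congr
    intro t ht
    rw [h t ht.1]
  · congr 1
    apply image_congr
    intro t ht
    rw [h t (lt_trans one_pos ht)]

end
end

section
/- Fix 1 < p < ∞, b ∈ (0, ∞], let φ be a non-trivial weight on I_b = (0, b), and let ψ be its dual weight. Then there exists a constant B > 0, independent of h, such that for all h ∈ M₊(I_b): (∫₀ᵇ ((Ph)(t) + (Qh)(t))^p φ(t) dt)^{1/p} ≤ B (∫₀ᵇ h(t)^p ψ(t)^{1-p} dt)^{1/p}. -/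
open MeasureTheory Set ENNReal Filter

noncomputable section

lemma rpow_anti {z : ℝ} {x y : ℝ≥0∞} (hz : z ≤ 0) (h : x ≤ y) : y ^ z ≤ x ^ z := by
  rw [← neg_neg z, ENNReal.rpow_neg, ENNReal.rpow_neg x, ENNReal.inv_le_inv]
  exact ENNReal.rpow_le_rpow h (by linarith)

lemma aux_Iio (μ : Measure ℝ) [NullSingletonClass μ] (y : ℝ≥0∞) : μ {x | μ (Iio x) ≤ y} ≤ y := by
  set S := {x | μ (Iio x) ≤ y} with hS
  have key : ∀ (u : ℕ → ℝ), Monotone u → (∀ n, u n ∈ S) → μ (⋃ n, Iio (u n)) ≤ y := by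
    intro u hu h
    rw [Monotone.measure_iUnion (fun i j hij => Iio_subset_Iio (hu hij))]
    exact iSup_le h
  have low : ∀ x ∈ S, ∀ z ≤ x, z ∈ S := fun x hx z hz =>
    le_trans (measure_mono (Iio_subset_Iio hz)) hx
  by_cases hne : S.Nonempty
  · by_cases hbd : BddAbove S
    · have hlub := isLUB_csSup hne hbd
      set c := sSup S
      have hsub : S ⊆ Iic c := fun x hx => hlub.1 hx
      have hin : ∀ z < c, z ∈ S := by
        intro z hz
        obtain ⟨x, hx, hzx⟩ := exists_lt_of_lt_csSup hne hz
        exact low x hx z hzx.le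
      obtain ⟨u, hu, huc, hlim⟩ := exists_seq_strictMono_tendsto c
      calc μ S ≤ μ (Iic c) := measure_mono hsub
        _ = μ (Iio c) := (measure_congr Iio_ae_eq_Iic).symm
        _ ≤ μ (⋃ n, Iio (u n)) := by
            apply measure_mono
            intro x hx
            obtain ⟨n, hn⟩ := (hlim.eventually (lt_mem_nhds hx)).exists
            exact mem_iUnion.2 ⟨n, hn⟩
        _ ≤ y := key u hu.monotone (fun n => hin _ (huc n))
    · have hall : ∀ z, z ∈ S := by
        intro z
        rw [not_bddAbove_iff] at hbd
        obtain ⟨x, hx, hzx⟩ := hbd z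
        exact low x hx z hzx.le
      calc μ S ≤ μ (⋃ n : ℕ, Iio (n : ℝ)) := by
            apply measure_mono
            intro x _
            obtain ⟨n, hn⟩ := exists_nat_gt x
            exact mem_iUnion.2 ⟨n, hn⟩
        _ ≤ y := key _ Nat.mono_cast (fun n => hall _)
  · rw [not_nonempty_iff_eq_empty.1 hne]; simp

lemma aux_Ioi (μ : Measure ℝ) [NullSingletonClass μ] (y : ℝ≥0∞) : μ {x | μ (Ioi x) ≤ y} ≤ y := by
  set S := {x | μ (Ioi x) ≤ y} with hS
  have key : ∀ (u : ℕ → ℝ), Antitone u → (∀ n, u n ∈ S) → μ (⋃ n, Ioi (u n)) ≤ y := by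
    intro u hu h
    rw [Monotone.measure_iUnion (fun i j hij => Ioi_subset_Ioi (hu hij))]
    exact iSup_le h
  have low : ∀ x ∈ S, ∀ z, x ≤ z → z ∈ S := fun x hx z hz =>
    le_trans (measure_mono (Ioi_subset_Ioi hz)) hx
  by_cases hne : S.Nonempty
  · by_cases hbd : BddBelow S
    · have hlub := isGLB_csInf hne hbd
      set c := sInf S
      have hsub : S ⊆ Ici c := fun x hx => hlub.1 hx
      have hin : ∀ z, c < z → z ∈ S := by
        intro z hz
        obtain ⟨x, hx, hzx⟩ := exists_lt_of_csInf_lt hne hz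
        exact low x hx z hzx.le
      obtain ⟨u, hu, huc, hlim⟩ := exists_seq_strictAnti_tendsto c
      calc μ S ≤ μ (Ici c) := measure_mono hsub
        _ = μ (Ioi c) := (measure_congr Ioi_ae_eq_Ici).symm
        _ ≤ μ (⋃ n, Ioi (u n)) := by
            apply measure_mono
            intro x hx
            obtain ⟨n, hn⟩ := (hlim.eventually (gt_mem_nhds hx)).exists
            exact mem_iUnion.2 ⟨n, hn⟩
        _ ≤ y := key u hu.antitone (fun n => hin _ (huc n))
    · have hall : ∀ z, z ∈ S := by
        intro z
        rw [not_bddBelow_iff] at hbd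
        obtain ⟨x, hx, hzx⟩ := hbd z
        exact low x hx z hzx.le
      calc μ S ≤ μ (⋃ n : ℕ, Ioi (-(n : ℝ))) := by
            apply measure_mono
            intro x _
            obtain ⟨n, hn⟩ := exists_nat_gt (-x)
            exact mem_iUnion.2 ⟨n, by simp only [mem_Ioi]; linarith⟩
        _ ≤ y := key _ (fun i j hij => by simpa using hij) (fun n => hall _)
  · rw [not_nonempty_iff_eq_empty.1 hne]; simp

lemma dyad_down (y z : ℝ≥0∞) (hy : y ≠ ⊤) (hz : z ≠ 0) (hzy : z ≤ y) :
    ∃ k : ℕ, y * 2 ^ (-(k:ℝ) - 1) ≤ z ∧ z ≤ y * 2 ^ (-(k:ℝ)) := by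
  have hzt : z ≠ ⊤ := ne_top_of_le_ne_top hy hzy
  have hy0 : y ≠ 0 := fun h => hz (by simpa [h] using hzy)
  have hz' := ENNReal.toReal_pos hz hzt
  have hy' := ENNReal.toReal_pos hy0 hy
  have h1 : (1:ℝ) ≤ y.toReal / z.toReal := by
    rw [le_div_iff₀ hz', one_mul]; exact ENNReal.toReal_mono hy hzy
  obtain ⟨n, hn1, hn2⟩ := exists_nat_pow_near h1 (by norm_num : (1:ℝ) < 2)
  rw [le_div_iff₀ hz'] at hn1
  rw [div_lt_iff₀ hz'] at hn2
  refine ⟨n, ?_, ?_⟩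
  · rw [← ENNReal.toReal_le_toReal (by finiteness) hzt, ENNReal.toReal_mul, ← ENNReal.toReal_rpow]
    rw [show (-(n:ℝ) - 1) = -((n+1 : ℕ):ℝ) by push_cast; ring, Real.rpow_neg (by simp),
      Real.rpow_natCast]
    rw [← div_eq_mul_inv, div_le_iff₀ (by simp)]
    simp; linarith
  · rw [← ENNReal.toReal_le_toReal hzt (by finiteness), ENNReal.toReal_mul, ← ENNReal.toReal_rpow]
    rw [Real.rpow_neg (by simp), Real.rpow_natCast]
    rw [← div_eq_mul_inv, le_div_iff₀ (by simp)]
    simp; linarith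

lemma dyad_up (y z : ℝ≥0∞) (hy : y ≠ 0) (hz : z ≠ ⊤) (hzy : y ≤ z) :
    ∃ k : ℕ, y * 2 ^ (k:ℝ) ≤ z ∧ z ≤ y * 2 ^ ((k:ℝ) + 1) := by
  have hyt : y ≠ ⊤ := ne_top_of_le_ne_top hz hzy
  have hz0 : z ≠ 0 := fun h => hy (by simpa [h] using hzy)
  have hz' := ENNReal.toReal_pos hz0 hz
  have hy' := ENNReal.toReal_pos hy hyt
  have h1 : (1:ℝ) ≤ z.toReal / y.toReal := by
    rw [le_div_iff₀ hy', one_mul]; exact ENNReal.toReal_mono hz hzy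
  obtain ⟨n, hn1, hn2⟩ := exists_nat_pow_near h1 (by norm_num : (1:ℝ) < 2)
  rw [le_div_iff₀ hy'] at hn1
  rw [div_lt_iff₀ hy'] at hn2
  refine ⟨n, ?_, ?_⟩
  · rw [← ENNReal.toReal_le_toReal (by finiteness) hz, ENNReal.toReal_mul, ← ENNReal.toReal_rpow]
    rw [Real.rpow_natCast]
    simp; linarith
  · rw [← ENNReal.toReal_le_toReal hz (by finiteness), ENNReal.toReal_mul, ← ENNReal.toReal_rpow]
    rw [show ((n:ℝ) + 1) = ((n+1 : ℕ):ℝ) by push_cast; ring, Real.rpow_natCast]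
    simp; linarith

lemma lemA (a : ℝ) (ha0 : 0 < a) (ha1 : a < 1) : ∃ C : ℝ≥0∞, C ≠ ⊤ ∧
    ∀ (μ : Measure ℝ) (F : ℝ → ℝ≥0∞), Measurable F → (∀ y, μ {x | F x ≤ y} ≤ y) →
    ∀ y ≠ ⊤, ∫⁻ x in {x | F x ≤ y}, F x ^ (-a) ∂μ ≤ C * y ^ (1 - a) := by
  have hr : (2:ℝ≥0∞) ^ (a - 1) < 1 := ENNReal.rpow_lt_one_of_one_lt_of_neg (by norm_num) (by linarith)
  refine ⟨2 ^ a * (1 - 2 ^ (a - 1))⁻¹, ?_, ?_⟩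
  · refine ENNReal.mul_ne_top (by finiteness) (ENNReal.inv_ne_top.2 ?_)
    exact (tsub_pos_of_lt hr).ne'
  intro μ F hF hμ y hy
  by_cases hy0 : y = 0
  · have : μ {x | F x ≤ y} = 0 := by simpa [hy0] using hμ y
    rw [Measure.restrict_eq_zero.2 this]; simp
  let S : ℕ → Set ℝ := fun k => {x | y * 2 ^ (-(k:ℝ) - 1) ≤ F x ∧ F x ≤ y * 2 ^ (-(k:ℝ))}
  have hS : ∀ k, MeasurableSet (S k) := fun k =>
    (measurableSet_le measurable_const hF).inter (measurableSet_le hF measurable_const)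
  have hsub : {x | F x ≤ y} ⊆ {x | F x ≤ 0} ∪ ⋃ k, S k := by
    intro x hx
    by_cases h0 : F x = 0
    · left; simp [h0]
    · right
      obtain ⟨k, hk⟩ := dyad_down y (F x) hy h0 hx
      exact mem_iUnion.2 ⟨k, hk⟩
  have hz : μ {x | F x ≤ 0} = 0 := by simpa using hμ 0
  calc ∫⁻ x in {x | F x ≤ y}, F x ^ (-a) ∂μ
      ≤ ∫⁻ x in {x | F x ≤ 0} ∪ ⋃ k, S k, F x ^ (-a) ∂μ := lintegral_mono_set hsub
    _ ≤ ∫⁻ x in {x | F x ≤ 0}, F x ^ (-a) ∂μ + ∫⁻ x in ⋃ k, S k, F x ^ (-a) ∂μ :=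
        lintegral_union_le _ _ _
    _ = ∫⁻ x in ⋃ k, S k, F x ^ (-a) ∂μ := by
        rw [Measure.restrict_eq_zero.2 hz]; simp
    _ ≤ ∑' k, ∫⁻ x in S k, F x ^ (-a) ∂μ := lintegral_iUnion_le _ _
    _ ≤ ∑' k : ℕ, 2 ^ a * y ^ (1 - a) * (2 ^ (a - 1)) ^ k := by
        refine ENNReal.tsum_le_tsum fun k => ?_
        calc ∫⁻ x in S k, F x ^ (-a) ∂μ
            ≤ ∫⁻ x in S k, (y * 2 ^ (-(k:ℝ) - 1)) ^ (-a) ∂μ := by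
              refine setLIntegral_mono' (hS k) fun x hx => ?_
              exact rpow_anti (by linarith) hx.1
          _ = (y * 2 ^ (-(k:ℝ) - 1)) ^ (-a) * μ (S k) := by simp
          _ ≤ (y * 2 ^ (-(k:ℝ) - 1)) ^ (-a) * (y * 2 ^ (-(k:ℝ))) := by
              gcongr
              exact (measure_mono fun x hx => hx.2).trans (hμ _)
          _ = _ := by
              rw [ENNReal.mul_rpow_of_ne_top hy (by finiteness), ← ENNReal.rpow_mul,
                ← ENNReal.rpow_natCast, ← ENNReal.rpow_mul]
              rw [show y ^ (-a) * 2 ^ ((-(k:ℝ) - 1) * -a) * (y * 2 ^ (-(k:ℝ))) =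
                (y ^ (-a) * y ^ (1:ℝ)) * (2 ^ ((-(k:ℝ) - 1) * -a) * 2 ^ (-(k:ℝ))) by
                  rw [ENNReal.rpow_one]; ring]
              rw [← ENNReal.rpow_add _ _ hy0 hy, ← ENNReal.rpow_add _ _ (by simp) (by simp),
                mul_comm (2 ^ a), mul_assoc, ← ENNReal.rpow_add _ _ (by simp) (by simp)]
              congr 2 <;> ring
    _ = 2 ^ a * y ^ (1 - a) * (1 - 2 ^ (a - 1))⁻¹ := by
        rw [ENNReal.tsum_mul_left, ENNReal.tsum_geometric]
    _ = _ := by ring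

lemma lemB (a : ℝ) (ha1 : 1 < a) : ∃ C : ℝ≥0∞, C ≠ ⊤ ∧
    ∀ (μ : Measure ℝ) (F : ℝ → ℝ≥0∞), Measurable F → (∀ y, μ {x | F x ≤ y} ≤ y) →
    ∀ y ≠ ⊤, y ≠ 0 → ∫⁻ x in {x | y ≤ F x}, F x ^ (-a) ∂μ ≤ C * y ^ (1 - a) := by
  have hr : (2:ℝ≥0∞) ^ (1 - a) < 1 := ENNReal.rpow_lt_one_of_one_lt_of_neg (by norm_num) (by linarith)
  refine ⟨2 * (1 - 2 ^ (1 - a))⁻¹, ?_, ?_⟩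
  · refine ENNReal.mul_ne_top (by finiteness) (ENNReal.inv_ne_top.2 ?_)
    exact (tsub_pos_of_lt hr).ne'
  intro μ F hF hμ y hy hy0
  let S : ℕ → Set ℝ := fun k => {x | y * 2 ^ (k:ℝ) ≤ F x ∧ F x ≤ y * 2 ^ ((k:ℝ) + 1)}
  have hS : ∀ k, MeasurableSet (S k) := fun k =>
    (measurableSet_le measurable_const hF).inter (measurableSet_le hF measurable_const)
  have hsub : {x | y ≤ F x} ⊆ {x | F x = ⊤} ∪ ⋃ k, S k := by
    intro x hx
    by_cases h0 : F x = ⊤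
    · left; simp [h0]
    · right
      obtain ⟨k, hk⟩ := dyad_up y (F x) hy0 h0 hx
      exact mem_iUnion.2 ⟨k, hk⟩
  calc ∫⁻ x in {x | y ≤ F x}, F x ^ (-a) ∂μ
      ≤ ∫⁻ x in {x | F x = ⊤} ∪ ⋃ k, S k, F x ^ (-a) ∂μ := lintegral_mono_set hsub
    _ ≤ ∫⁻ x in {x | F x = ⊤}, F x ^ (-a) ∂μ + ∫⁻ x in ⋃ k, S k, F x ^ (-a) ∂μ :=
        lintegral_union_le _ _ _
    _ = ∫⁻ x in ⋃ k, S k, F x ^ (-a) ∂μ := by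
        have : ∫⁻ x in {x | F x = ⊤}, F x ^ (-a) ∂μ = ∫⁻ x in {x | F x = ⊤}, 0 ∂μ := by
          refine setLIntegral_congr_fun (hF (measurableSet_singleton _)) fun x hx => ?_
          simp only [mem_ofPred_eq] at hx
          simp only [hx]
          exact ENNReal.top_rpow_of_neg (by linarith)
        rw [this]; simp
    _ ≤ ∑' k, ∫⁻ x in S k, F x ^ (-a) ∂μ := lintegral_iUnion_le _ _
    _ ≤ ∑' k : ℕ, 2 * y ^ (1 - a) * (2 ^ (1 - a)) ^ k := by
        refine ENNReal.tsum_le_tsum fun k => ?_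
        calc ∫⁻ x in S k, F x ^ (-a) ∂μ
            ≤ ∫⁻ x in S k, (y * 2 ^ (k:ℝ)) ^ (-a) ∂μ := by
              refine setLIntegral_mono' (hS k) fun x hx => ?_
              exact rpow_anti (by linarith) hx.1
          _ = (y * 2 ^ (k:ℝ)) ^ (-a) * μ (S k) := by simp
          _ ≤ (y * 2 ^ (k:ℝ)) ^ (-a) * (y * 2 ^ ((k:ℝ) + 1)) := by
              gcongr
              exact (measure_mono fun x hx => hx.2).trans (hμ _)
          _ = _ := by
              rw [ENNReal.mul_rpow_of_ne_top hy (by finiteness), ← ENNReal.rpow_mul,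
                ← ENNReal.rpow_natCast, ← ENNReal.rpow_mul]
              rw [show y ^ (-a) * 2 ^ ((k:ℝ) * -a) * (y * 2 ^ ((k:ℝ) + 1)) =
                (y ^ (-a) * y ^ (1:ℝ)) * (2 ^ ((k:ℝ) * -a) * 2 ^ ((k:ℝ) + 1)) by
                  rw [ENNReal.rpow_one]; ring]
              rw [show 2 * y ^ (1 - a) * 2 ^ ((1 - a) * (k:ℝ)) =
                 y ^ (1 - a) * (2 ^ (1:ℝ) * 2 ^ ((1 - a) * (k:ℝ))) by
                  rw [ENNReal.rpow_one]; ring]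
              rw [← ENNReal.rpow_add _ _ hy0 hy, ← ENNReal.rpow_add _ _ (by simp) (by simp),
                ← ENNReal.rpow_add _ _ (by simp) (by simp)]
              congr 2 <;> ring
    _ = 2 * y ^ (1 - a) * (1 - 2 ^ (1 - a))⁻¹ := by
        rw [ENNReal.tsum_mul_left, ENNReal.tsum_geometric]
    _ = _ := by ring

lemma hardy_abs (p : ℝ) (hp : 1 < p) : ∃ C : ℝ≥0∞, C ≠ ⊤ ∧
    ∀ (lam : Measure ℝ) [SFinite lam] (φ ψ F : ℝ → ℝ≥0∞) (R : Set (ℝ × ℝ)) (K : ℝ≥0∞),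
    Measurable φ → Measurable ψ → Measurable F → MeasurableSet R →
    (∀ y, ∫⁻ t in {t | F t ≤ y}, φ t ∂lam ≤ y) →
    (∀ y ≠ ⊤, y ≠ 0 → ∫⁻ s in {s | y ≤ F s}, ψ s * F s ^ (1 / (p * (p - 1))) ∂lam
        ≤ K * y ^ (-(1 / p))) →
    (∀ᵐ t ∂lam, F t ≠ 0 ∧ F t ≠ ⊤) → (∀ᵐ t ∂lam, ψ t ≠ 0 ∧ ψ t ≠ ⊤) →
    (∀ s t, (s, t) ∈ R → F t ≤ F s) →
    ∀ h : ℝ → ℝ≥0∞, Measurable h →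
      ∫⁻ t, (∫⁻ s, R.indicator (fun _ => 1) (s, t) * h s ∂lam) ^ p * φ t ∂lam ≤
        K ^ (p - 1) * C * ∫⁻ s, h s ^ p * ψ s ^ (1 - p) ∂lam := by
  have hp0 : 0 < p := by linarith
  have hp1 : 0 < p - 1 := by linarith
  obtain ⟨C, hC, hA⟩ := lemA ((p - 1) / p) (by positivity)
    (by rw [div_lt_one hp0]; linarith)
  refine ⟨C, hC, ?_⟩
  intro lam _ φ ψ F R K hφ hψ hF hR hμ hν hFae hψae hRF h hh
  set q := p / (p - 1) with hq
  have hpq : p.HolderConjugate q := Real.HolderConjugate.conjExponent hp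
  have hq0 : 0 < q := by positivity
  let I : ℝ → ℝ → ℝ≥0∞ := fun s t => R.indicator (fun _ => 1) (s, t)
  have hI : Measurable (fun z : ℝ × ℝ => I z.1 z.2) := by
    exact measurable_const.indicator hR
  have hI1 : ∀ s t, I s t = 0 ∨ I s t = 1 := by
    intro s t; by_cases hst : (s, t) ∈ R <;> simp [I, hst]
  have hIp : ∀ s t (r : ℝ), 0 < r → I s t ^ r = I s t := by
    intro s t r hr
    rcases hI1 s t with h' | h' <;> simp [h', hr]
  have hII : ∀ s t, I s t * I s t = I s t := by
    intro s t
    rcases hI1 s t with h' | h' <;> simp [h']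
  have hIs : ∀ t, Measurable fun s => I s t := fun t => hI.comp measurable_prodMk_right
  have hIt : ∀ s, Measurable fun t => I s t := fun s => hI.comp measurable_prodMk_left
  let g : ℝ → ℝ≥0∞ := fun s => h s ^ p * ψ s ^ (1 - p) * F s ^ (-(1 / p))
  have hg : Measurable g := by fun_prop
  have step1 : ∀ t, F t ≠ 0 → F t ≠ ⊤ → (∫⁻ s, I s t * h s ∂lam) ^ p ≤
      K ^ (p - 1) * F t ^ (-((p - 1) / p)) * ∫⁻ s, I s t * g s ∂lam := by
    intro t ht0 ht1
    let u : ℝ → ℝ≥0∞ := fun s => I s t * (h s * ψ s ^ (-(1 / q)) * F s ^ (-(1 / p ^ 2)))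
    let v : ℝ → ℝ≥0∞ := fun s => I s t * (ψ s ^ (1 / q) * F s ^ (1 / p ^ 2))
    have hu : Measurable u := by have := hIs t; fun_prop
    have hv : Measurable v := by have := hIs t; fun_prop
    have e0 : ∫⁻ s, I s t * h s ∂lam = ∫⁻ s, (u * v) s ∂lam := by
      refine lintegral_congr_ae ?_
      filter_upwards [hFae, hψae] with s h1 h2
      have e1 : ψ s ^ (-(1 / q)) * ψ s ^ (1 / q) = 1 := by
        rw [← ENNReal.rpow_add _ _ h2.1 h2.2]; simp
      have e2 : F s ^ (-(1 / p ^ 2)) * F s ^ (1 / p ^ 2) = 1 := by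
        rw [← ENNReal.rpow_add _ _ h1.1 h1.2]; simp
      calc I s t * h s = (I s t * I s t) * h s * (ψ s ^ (-(1 / q)) * ψ s ^ (1 / q)) *
            (F s ^ (-(1 / p ^ 2)) * F s ^ (1 / p ^ 2)) := by rw [e1, e2, hII]; simp
        _ = _ := by simp only [Pi.mul_apply, u, v]; ring
    have e1 : ∀ s, u s ^ p = I s t * g s := by
      intro s
      simp only [u, g]
      rw [ENNReal.mul_rpow_of_nonneg _ _ hp0.le, ENNReal.mul_rpow_of_nonneg _ _ hp0.le,
        ENNReal.mul_rpow_of_nonneg _ _ hp0.le, hIp _ _ _ hp0, ← ENNReal.rpow_mul,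
        ← ENNReal.rpow_mul]
      congr 3
      · congr 1; rw [hq]; field_simp; ring
      · field_simp
    have e2 : ∀ s, v s ^ q = I s t * (ψ s * F s ^ (1 / (p * (p - 1)))) := by
      intro s
      simp only [v]
      rw [ENNReal.mul_rpow_of_nonneg _ _ hq0.le, ENNReal.mul_rpow_of_nonneg _ _ hq0.le,
        hIp _ _ _ hq0, ← ENNReal.rpow_mul, ← ENNReal.rpow_mul]
      congr 2
      · rw [one_div_mul_cancel hq0.ne', ENNReal.rpow_one]
      · congr 1; rw [hq]; field_simp
    have e3 : ∫⁻ s, v s ^ q ∂lam ≤ K * F t ^ (-(1 / p)) := by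
      refine le_trans ?_ (hν (F t) ht1 ht0)
      rw [← lintegral_indicator (measurableSet_le measurable_const hF)]
      refine lintegral_mono fun s => ?_
      rw [e2]
      by_cases hst : (s, t) ∈ R
      · have : s ∈ {s | F t ≤ F s} := hRF s t hst
        rw [indicator_of_mem this]
        simp [I, hst]
      · simp [I, hst]
    rw [e0]
    calc (∫⁻ s, (u * v) s ∂lam) ^ p
        ≤ ((∫⁻ s, u s ^ p ∂lam) ^ (1 / p) * (∫⁻ s, v s ^ q ∂lam) ^ (1 / q)) ^ p := by
          gcongr
          exact ENNReal.lintegral_mul_le_Lp_mul_Lq lam hpq hu.aemeasurable hv.aemeasurable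
      _ ≤ ((∫⁻ s, u s ^ p ∂lam) ^ (1 / p) * (K * F t ^ (-(1 / p))) ^ (1 / q)) ^ p := by
          gcongr
      _ = (∫⁻ s, I s t * g s ∂lam) * (K * F t ^ (-(1 / p))) ^ (p - 1) := by
          rw [ENNReal.mul_rpow_of_nonneg _ _ hp0.le, ← ENNReal.rpow_mul, ← ENNReal.rpow_mul,
            one_div_mul_cancel hp0.ne', ENNReal.rpow_one]
          simp only [e1]
          congr 2
          rw [hq]; field_simp
      _ = _ := by
          rw [ENNReal.mul_rpow_of_nonneg _ _ hp1.le, ← ENNReal.rpow_mul, mul_comm]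
          congr 3
          field_simp
  have hFm : Measurable fun t => F t ^ (-((p - 1) / p)) := by fun_prop
  have inner : ∀ s, F s ≠ ⊤ →
      ∫⁻ t, I s t * (F t ^ (-((p - 1) / p)) * φ t) ∂lam ≤ C * F s ^ (1 / p) := by
    intro s hs
    have hset : ∀ y, MeasurableSet {x | F x ≤ y} := fun y => measurableSet_le hF measurable_const
    have := hA (lam.withDensity φ) F hF (fun y => by
      rw [withDensity_apply _ (hset y)]; exact hμ y) (F s) hs
    rw [show 1 - (p - 1) / p = 1 / p by field_simp; ring] at this
    refine le_trans ?_ this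
    rw [restrict_withDensity (hset _), lintegral_withDensity_eq_lintegral_mul _ hφ hFm,
      ← lintegral_indicator (hset _)]
    refine lintegral_mono fun t => ?_
    by_cases hst : (s, t) ∈ R
    · have : t ∈ {x | F x ≤ F s} := hRF s t hst
      rw [indicator_of_mem this]
      simp [I, hst, mul_comm]
    · simp [I, hst]
  calc ∫⁻ t, (∫⁻ s, I s t * h s ∂lam) ^ p * φ t ∂lam
      ≤ ∫⁻ t, K ^ (p - 1) * ∫⁻ s, g s * (I s t * (F t ^ (-((p - 1) / p)) * φ t)) ∂lam ∂lam := by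
        refine lintegral_mono_ae ?_
        filter_upwards [hFae] with t ht
        calc _ ≤ (K ^ (p - 1) * F t ^ (-((p - 1) / p)) * ∫⁻ s, I s t * g s ∂lam) * φ t := by
              gcongr; exact step1 t ht.1 ht.2
          _ = K ^ (p - 1) * ((∫⁻ s, I s t * g s ∂lam) * (F t ^ (-((p - 1) / p)) * φ t)) := by ring
          _ = _ := by
              rw [← lintegral_mul_const _ ((hIs t).fun_mul hg)]
              congr 2; ext s; ring
    _ = K ^ (p - 1) * ∫⁻ t, ∫⁻ s, g s * (I s t * (F t ^ (-((p - 1) / p)) * φ t)) ∂lam ∂lam := by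
        rw [lintegral_const_mul]
        apply Measurable.lintegral_prod_left' (f := fun z : ℝ × ℝ =>
          g z.1 * (I z.1 z.2 * (F z.2 ^ (-((p - 1) / p)) * φ z.2)))
        fun_prop
    _ = K ^ (p - 1) * ∫⁻ s, g s * ∫⁻ t, (I s t * (F t ^ (-((p - 1) / p)) * φ t)) ∂lam ∂lam := by
        rw [lintegral_lintegral_swap]
        · congr 2; ext s
          rw [lintegral_const_mul]
          exact (hIt s).fun_mul (hFm.fun_mul hφ)
        · apply Measurable.aemeasurable
          have : Measurable fun z : ℝ × ℝ => I z.2 z.1 := hI.comp measurable_swap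
          show Measurable fun z : ℝ × ℝ => g z.2 * (I z.2 z.1 * (F z.1 ^ (-((p - 1) / p)) * φ z.1))
          fun_prop
    _ ≤ K ^ (p - 1) * ∫⁻ s, C * (h s ^ p * ψ s ^ (1 - p)) ∂lam := by
        gcongr K ^ (p - 1) * ?_
        refine lintegral_mono_ae ?_
        filter_upwards [hFae] with s hs
        calc _ ≤ g s * (C * F s ^ (1 / p)) := by gcongr; exact inner s hs.2
          _ = C * (h s ^ p * ψ s ^ (1 - p)) * (F s ^ (-(1 / p)) * F s ^ (1 / p)) := by
              simp only [g]; ring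
          _ = _ := by rw [← ENNReal.rpow_add _ _ hs.1 hs.2]; simp
    _ = _ := by
        rw [lintegral_const_mul' _ _ hC]; ring

/-- `∫ φ(t) max(x,t)^(-p) dt` over `I_b`. -/
def Fmax (b : ℝ≥0∞) (p : ℝ) (φ : ℝ → ℝ≥0∞) (x : ℝ) : ℝ≥0∞ :=
  ∫⁻ t in IbSet b, φ t * ENNReal.ofReal ((max x t) ^ (-p))

/-- `∫ φ(t) t^(-p) min(x,t)^p dt` over `I_b`. -/
def Emin (b : ℝ≥0∞) (p : ℝ) (φ : ℝ → ℝ≥0∞) (x : ℝ) : ℝ≥0∞ :=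
  ∫⁻ t in IbSet b, φ t * (ENNReal.ofReal (t ^ (-p)) * (ENNReal.ofReal (min x t)) ^ p)

lemma meas_Ib (b : ℝ≥0∞) : MeasurableSet (IbSet b) :=
  (measurableSet_lt measurable_const measurable_id).inter
    (measurableSet_lt ENNReal.measurable_ofReal measurable_const)

lemma meas_tail (b : ℝ≥0∞) (t : ℝ) : MeasurableSet {s : ℝ | t < s ∧ ENNReal.ofReal s < b} :=
  (measurableSet_lt measurable_const measurable_id).inter
    (measurableSet_lt ENNReal.measurable_ofReal measurable_const)

lemma Ioo_sub_Ib {b : ℝ≥0∞} {x : ℝ} (hx : x ∈ IbSet b) : Ioo 0 x ⊆ IbSet b := fun t ht =>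
  ⟨ht.1, lt_of_le_of_lt (ENNReal.ofReal_le_ofReal ht.2.le) hx.2⟩

lemma tail_eq {b : ℝ≥0∞} {x : ℝ} (hx : 0 ≤ x) :
    {s : ℝ | x < s ∧ ENNReal.ofReal s < b} = IbSet b ∩ Ioi x := by
  ext s
  constructor
  · rintro ⟨h1, h2⟩; exact ⟨⟨hx.trans_lt h1, h2⟩, h1⟩
  · rintro ⟨⟨_, h2⟩, h1⟩; exact ⟨h1, h2⟩

lemma head_eq {b : ℝ≥0∞} {x : ℝ} (hx : x ∈ IbSet b) : Ioo 0 x = IbSet b ∩ Iio x := by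
  ext s
  constructor
  · intro h; exact ⟨Ioo_sub_Ib hx h, h.2⟩
  · rintro ⟨⟨h2, _⟩, h1⟩; exact ⟨h2, h1⟩

lemma split_Ib {b : ℝ≥0∞} {x : ℝ} (hx : x ∈ IbSet b) (f : ℝ → ℝ≥0∞) :
    ∫⁻ t in IbSet b, f t = (∫⁻ t in Ioo 0 x, f t) +
      ∫⁻ t in {s : ℝ | x < s ∧ ENNReal.ofReal s < b}, f t := by
  have e : IbSet b = Ioc 0 x ∪ {s : ℝ | x < s ∧ ENNReal.ofReal s < b} := by
    ext s
    constructor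
    · rintro ⟨h1, h2⟩
      rcases le_or_gt s x with h | h
      · left; exact ⟨h1, h⟩
      · right; exact ⟨h, h2⟩
    · rintro (h | h)
      · exact ⟨h.1, lt_of_le_of_lt (ENNReal.ofReal_le_ofReal h.2) hx.2⟩
      · exact ⟨hx.1.trans h.1, h.2⟩
  rw [e, lintegral_union (meas_tail b x), ← Measure.restrict_congr_set Ioo_ae_eq_Ioc]
  rw [Set.disjoint_left]
  intro s h1 h2
  exact absurd h1.2 (not_le.2 h2.1)

lemma Fmax_eq {b : ℝ≥0∞} {p : ℝ} {φ : ℝ → ℝ≥0∞} {x : ℝ} (hx : x ∈ IbSet b) :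
    Fmax b p φ x = ENNReal.ofReal (x ^ (-p)) * intPhi φ x + tailP b p φ x := by
  rw [Fmax, split_Ib hx, intPhi, tailP, ← lintegral_const_mul' _ _ ENNReal.ofReal_ne_top]
  congr 1
  · refine setLIntegral_congr_fun measurableSet_Ioo fun t ht => ?_
    simp only [max_eq_left ht.2.le, mul_comm]
  · refine setLIntegral_congr_fun (meas_tail b x) fun t ht => ?_
    simp only [max_eq_right ht.1.le]

lemma Emin_eq {b : ℝ≥0∞} {p : ℝ} {φ : ℝ → ℝ≥0∞} {x : ℝ} (hx : x ∈ IbSet b) :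
    Emin b p φ x = DPhi b p φ x := by
  rw [Emin, split_Ib hx, DPhi, intPhi, tailP, ← lintegral_const_mul' _ _ ENNReal.ofReal_ne_top]
  congr 1
  · refine setLIntegral_congr_fun measurableSet_Ioo fun t ht => ?_
    simp only [min_eq_right ht.2.le]
    rw [ENNReal.ofReal_rpow_of_pos ht.1, ← ENNReal.ofReal_mul (by have := ht.1; positivity),
      ← Real.rpow_add ht.1]
    simp
  · refine setLIntegral_congr_fun (meas_tail b x) fun t ht => ?_
    simp only [min_eq_left ht.1.le]
    rw [ENNReal.ofReal_rpow_of_pos hx.1]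
    ring

lemma Fmax_anti (b : ℝ≥0∞) (p : ℝ) (hp : 1 < p) (φ : ℝ → ℝ≥0∞) : Antitone (Fmax b p φ) := by
  intro x y hxy
  refine setLIntegral_mono' (meas_Ib b) fun t ht => ?_
  gcongr φ t * ENNReal.ofReal ?_
  exact Real.rpow_le_rpow_of_nonpos (lt_max_of_lt_right ht.1) (max_le_max_right t hxy) (by linarith)

lemma Emin_mono (b : ℝ≥0∞) (p : ℝ) (hp : 1 < p) (φ : ℝ → ℝ≥0∞) : Monotone (Emin b p φ) := by
  intro x y hxy
  refine lintegral_mono fun t => ?_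
  gcongr

lemma intPhi_mono (φ : ℝ → ℝ≥0∞) : Monotone (intPhi φ) := fun _ _ h =>
  lintegral_mono_set (Ioo_subset_Ioo_right h)

lemma tailP_anti (b : ℝ≥0∞) (p : ℝ) (φ : ℝ → ℝ≥0∞) : Antitone (tailP b p φ) := fun _ _ h =>
  lintegral_mono_set fun _ hs => ⟨h.trans_lt hs.1, hs.2⟩

lemma meas_dual (b : ℝ≥0∞) (p : ℝ) (φ : ℝ → ℝ≥0∞) : Measurable (dualWeight b p φ) := by
  have h1 := (intPhi_mono φ).measurable
  have h2 := (tailP_anti b p φ).measurable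
  unfold dualWeight DPhi
  fun_prop

lemma int_Ioi (p : ℝ) (hp : 1 < p) (c : ℝ) (hc : 0 < c) :
    ∫⁻ y in Ioi c, ENNReal.ofReal (p * y ^ (-p - 1)) = ENNReal.ofReal (c ^ (-p)) := by
  rw [← ofReal_integral_eq_lintegral_ofReal]
  · rw [integral_const_mul, integral_Ioi_rpow_of_lt (by linarith) hc]
    congr 1
    rw [show -p - 1 + 1 = -p by ring]; field_simp
  · exact (integrableOn_Ioi_rpow_of_lt (by linarith) hc).const_mul p
  · filter_upwards [ae_restrict_mem measurableSet_Ioi] with y hy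
    have : 0 < y := hc.trans hy
    have : 0 < p := by linarith
    simp only [Pi.zero_apply]; positivity

lemma int_Ioo (p : ℝ) (hp : 1 < p) (c : ℝ) :
    ∫⁻ y in Ioo 0 c, ENNReal.ofReal (p * y ^ (p - 1)) = ENNReal.ofReal c ^ p := by
  rcases le_or_gt c 0 with hc | hc
  · rw [Ioo_eq_empty (by linarith), ENNReal.ofReal_of_nonpos hc]
    simp [show 0 < p by linarith]
  rw [ENNReal.ofReal_rpow_of_pos hc, Measure.restrict_congr_set Ioo_ae_eq_Ioc,
    ← ofReal_integral_eq_lintegral_ofReal]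
  · rw [← intervalIntegral.integral_of_le hc.le, intervalIntegral.integral_const_mul,
      integral_rpow (by left; linarith)]
    congr 1
    rw [show p - 1 + 1 = p by ring, Real.zero_rpow (by linarith)]; field_simp; ring
  · have := (intervalIntegral.intervalIntegrable_rpow' (a := 0) (b := c) (r := p - 1)
      (by linarith)).const_mul p
    rwa [intervalIntegrable_iff_integrableOn_Ioc_of_le hc.le] at this
  · filter_upwards [ae_restrict_mem measurableSet_Ioc] with y hy
    have : 0 < y := hy.1
    have : 0 < p := by linarith
    simp only [Pi.zero_apply]; positivity

lemma nsc_wd (b : ℝ≥0∞) (f : ℝ → ℝ≥0∞) :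
    NullSingletonClass ((volume.restrict (IbSet b)).withDensity f) :=
  ⟨fun x => withDensity_absolutelyContinuous _ _ (by simp)⟩

lemma Fmax_tonelli (b : ℝ≥0∞) (p : ℝ) (hp : 1 < p) (φ : ℝ → ℝ≥0∞) (hφ : Measurable φ) (x : ℝ) :
    ((volume.restrict (IbSet b)).withDensity
      (fun y => ENNReal.ofReal (p * y ^ (-p - 1)) * intPhi φ y)) (Ioi x) ≤ Fmax b p φ x := by
  rw [withDensity_apply _ measurableSet_Ioi, ← lintegral_indicator measurableSet_Ioi]
  set lam := volume.restrict (IbSet b) with hlam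
  let k : ℝ → ℝ → ℝ≥0∞ := fun y t =>
    ({z : ℝ × ℝ | x < z.1 ∧ z.2 < z.1}).indicator (fun _ => 1) (y, t)
  have hkm : Measurable fun z : ℝ × ℝ => k z.1 z.2 :=
    measurable_const.indicator ((measurableSet_lt measurable_const measurable_fst).inter
      (measurableSet_lt measurable_snd measurable_fst))
  have hk1 : ∀ y, Measurable fun t => k y t := fun y => hkm.comp measurable_prodMk_left
  have hk2 : ∀ t, Measurable fun y => k y t := fun y => hkm.comp measurable_prodMk_right
  have hc : Measurable fun y : ℝ => ENNReal.ofReal (p * y ^ (-p - 1)) := by fun_prop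
  calc ∫⁻ y, (Ioi x).indicator (fun y => ENNReal.ofReal (p * y ^ (-p - 1)) * intPhi φ y) y ∂lam
      ≤ ∫⁻ y, ∫⁻ t, ENNReal.ofReal (p * y ^ (-p - 1)) * (k y t * φ t) ∂lam ∂lam := by
        refine setLIntegral_mono' (meas_Ib b) fun y hy => ?_
        rw [lintegral_const_mul _ ((hk1 y).fun_mul hφ)]
        by_cases hxy : x < y
        · rw [indicator_of_mem (show y ∈ Ioi x from hxy), intPhi, head_eq hy]
          gcongr _ * ?_
          rw [inter_comm, ← Measure.restrict_restrict measurableSet_Iio,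
            ← lintegral_indicator measurableSet_Iio]
          refine lintegral_mono fun t => ?_
          by_cases ht : t < y
          · simp [k, ht, hxy]
          · simp [ht]
        · rw [indicator_of_notMem (show y ∉ Ioi x from hxy)]; simp
    _ = ∫⁻ t, ∫⁻ y, ENNReal.ofReal (p * y ^ (-p - 1)) * (k y t * φ t) ∂lam ∂lam := by
        rw [lintegral_lintegral_swap]
        apply Measurable.aemeasurable
        show Measurable fun z : ℝ × ℝ => ENNReal.ofReal (p * z.1 ^ (-p - 1)) * (k z.1 z.2 * φ z.2)
        fun_prop
    _ ≤ Fmax b p φ x := by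
        refine setLIntegral_mono' (meas_Ib b) fun t ht => ?_
        calc ∫⁻ y, ENNReal.ofReal (p * y ^ (-p - 1)) * (k y t * φ t) ∂lam
            = φ t * ∫⁻ y, ENNReal.ofReal (p * y ^ (-p - 1)) * k y t ∂lam := by
              rw [← lintegral_const_mul _ (hc.fun_mul (hk2 t))]
              congr 1; ext y; ring
          _ ≤ φ t * ∫⁻ y in Ioi (max x t), ENNReal.ofReal (p * y ^ (-p - 1)) := by
              gcongr φ t * ?_
              refine le_trans (lintegral_mono' Measure.restrict_le_self le_rfl) ?_
              rw [← lintegral_indicator measurableSet_Ioi]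
              refine lintegral_mono fun y => ?_
              by_cases hy : x < y ∧ t < y
              · rw [indicator_of_mem (show y ∈ Ioi (max x t) from max_lt hy.1 hy.2)]
                simp [k, hy]
              · simp [k, hy]
          _ = _ := by rw [int_Ioi p hp _ (lt_max_of_lt_right ht.1)]

lemma Emin_tonelli (b : ℝ≥0∞) (p : ℝ) (hp : 1 < p) (φ : ℝ → ℝ≥0∞) (hφ : Measurable φ) (x : ℝ) :
    ((volume.restrict (IbSet b)).withDensity
      (fun y => ENNReal.ofReal (p * y ^ (p - 1)) * tailP b p φ y)) (Iio x) ≤ Emin b p φ x := by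
  rw [withDensity_apply _ measurableSet_Iio, ← lintegral_indicator measurableSet_Iio]
  set lam := volume.restrict (IbSet b) with hlam
  let k : ℝ → ℝ → ℝ≥0∞ := fun y t =>
    ({z : ℝ × ℝ | z.1 < x ∧ z.1 < z.2}).indicator (fun _ => 1) (y, t)
  have hkm : Measurable fun z : ℝ × ℝ => k z.1 z.2 :=
    measurable_const.indicator ((measurableSet_lt measurable_fst measurable_const).inter
      (measurableSet_lt measurable_fst measurable_snd))
  have hk1 : ∀ y, Measurable fun t => k y t := fun y => hkm.comp measurable_prodMk_left
  have hk2 : ∀ t, Measurable fun y => k y t := fun y => hkm.comp measurable_prodMk_right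
  have hc : Measurable fun y : ℝ => ENNReal.ofReal (p * y ^ (p - 1)) := by fun_prop
  have hφ' : Measurable fun t => φ t * ENNReal.ofReal (t ^ (-p)) := by fun_prop
  calc ∫⁻ y, (Iio x).indicator (fun y => ENNReal.ofReal (p * y ^ (p - 1)) * tailP b p φ y) y ∂lam
      ≤ ∫⁻ y, ∫⁻ t, ENNReal.ofReal (p * y ^ (p - 1)) *
          (k y t * (φ t * ENNReal.ofReal (t ^ (-p)))) ∂lam ∂lam := by
        refine setLIntegral_mono' (meas_Ib b) fun y hy => ?_
        rw [lintegral_const_mul _ ((hk1 y).fun_mul hφ')]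
        by_cases hxy : y < x
        · rw [indicator_of_mem (show y ∈ Iio x from hxy), tailP, tail_eq hy.1.le]
          gcongr _ * ?_
          rw [inter_comm, ← Measure.restrict_restrict measurableSet_Ioi,
            ← lintegral_indicator measurableSet_Ioi]
          refine lintegral_mono fun t => ?_
          by_cases ht : y < t
          · simp [k, ht, hxy]
          · simp [ht]
        · rw [indicator_of_notMem (show y ∉ Iio x from hxy)]; simp
    _ = ∫⁻ t, ∫⁻ y, ENNReal.ofReal (p * y ^ (p - 1)) *
          (k y t * (φ t * ENNReal.ofReal (t ^ (-p)))) ∂lam ∂lam := by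
        rw [lintegral_lintegral_swap]
        apply Measurable.aemeasurable
        show Measurable fun z : ℝ × ℝ => ENNReal.ofReal (p * z.1 ^ (p - 1)) *
          (k z.1 z.2 * (φ z.2 * ENNReal.ofReal (z.2 ^ (-p))))
        fun_prop
    _ ≤ Emin b p φ x := by
        refine setLIntegral_mono' (meas_Ib b) fun t ht => ?_
        calc ∫⁻ y, ENNReal.ofReal (p * y ^ (p - 1)) *
              (k y t * (φ t * ENNReal.ofReal (t ^ (-p)))) ∂lam
            = (φ t * ENNReal.ofReal (t ^ (-p))) *
                ∫⁻ y, ENNReal.ofReal (p * y ^ (p - 1)) * k y t ∂lam := by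
              rw [← lintegral_const_mul _ (hc.fun_mul (hk2 t))]
              congr 1; ext y; ring
          _ ≤ (φ t * ENNReal.ofReal (t ^ (-p))) *
                ∫⁻ y in Ioo 0 (min x t), ENNReal.ofReal (p * y ^ (p - 1)) := by
              gcongr _ * ?_
              rw [← lintegral_indicator measurableSet_Ioo, hlam, ← lintegral_indicator (meas_Ib b)]
              refine lintegral_mono fun y => ?_
              by_cases hyb : y ∈ IbSet b
              · by_cases hy : y < x ∧ y < t
                · rw [indicator_of_mem hyb, indicator_of_mem
                    (show y ∈ Ioo 0 (min x t) from ⟨hyb.1, lt_min hy.1 hy.2⟩)]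
                  simp [k, hy]
                · simp [k, hy]
              · simp [hyb]
          _ = _ := by rw [int_Ioo p hp]; ring

lemma level_Ioi (m : Measure ℝ) [NullSingletonClass m] (F : ℝ → ℝ≥0∞)
    (h : ∀ x, m (Ioi x) ≤ F x) (y : ℝ≥0∞) : m {x | F x ≤ y} ≤ y :=
  (measure_mono fun x hx => (h x).trans hx).trans (aux_Ioi m y)

lemma level_Iio (m : Measure ℝ) [NullSingletonClass m] (F : ℝ → ℝ≥0∞)
    (h : ∀ x, m (Iio x) ≤ F x) (y : ℝ≥0∞) : m {x | F x ≤ y} ≤ y :=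
  (measure_mono fun x hx => (h x).trans hx).trans (aux_Iio m y)

lemma Fmax_wd (b : ℝ≥0∞) (p : ℝ) (φ : ℝ → ℝ≥0∞) (x : ℝ) :
    ((volume.restrict (IbSet b)).withDensity
      (fun y => φ y * ENNReal.ofReal (y ^ (-p)))) (Ioi x) ≤ Fmax b p φ x := by
  rw [withDensity_apply _ measurableSet_Ioi, ← lintegral_indicator measurableSet_Ioi]
  refine lintegral_mono fun t => ?_
  by_cases ht : x < t
  · rw [indicator_of_mem (show t ∈ Ioi x from ht), max_eq_right ht.le]
  · rw [indicator_of_notMem (show t ∉ Ioi x from ht)]; simp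

lemma Emin_wd (b : ℝ≥0∞) (p : ℝ) (φ : ℝ → ℝ≥0∞) (x : ℝ) :
    ((volume.restrict (IbSet b)).withDensity φ) (Iio x) ≤ Emin b p φ x := by
  rw [withDensity_apply _ measurableSet_Iio, ← lintegral_indicator measurableSet_Iio]
  refine setLIntegral_mono' (meas_Ib b) fun t ht0 => ?_
  by_cases ht : t < x
  · rw [indicator_of_mem (show t ∈ Iio x from ht), min_eq_right ht.le,
      ENNReal.ofReal_rpow_of_pos ht0.1, ← ENNReal.ofReal_mul (by have := ht0.1; positivity),
      ← Real.rpow_add ht0.1]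
    simp
  · rw [indicator_of_notMem (show t ∉ Iio x from ht)]; simp

lemma psi_bd1 (p q x : ℝ) (hp : 1 < p) (hpq : p + q = p * q) (hx : 0 < x)
    (A T : ℝ≥0∞) (hA : A ≠ 0) (hA' : A ≠ ⊤) (hT' : T ≠ ⊤) :
    ENNReal.ofReal (x ^ (p + q - 1)) * A * T / (A + ENNReal.ofReal (x ^ p) * T) ^ (q + 1) ≤
      ENNReal.ofReal (p * x ^ (-p - 1)) * A * (ENNReal.ofReal (x ^ (-p)) * A + T) ^ (-q) := by
  rw [ENNReal.ofReal_mul (by linarith)]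
  simp only [← ENNReal.ofReal_rpow_of_pos hx]
  set X := ENNReal.ofReal x with hX
  have hX0 : X ≠ 0 := by simp [hX, hx]
  have hX1 : X ≠ ⊤ := by simp [hX]
  set D := A + X ^ p * T with hD
  have hD0 : D ≠ 0 := fun h => hA (by simpa using (add_eq_zero.1 h).1)
  have hD1 : D ≠ ⊤ := ENNReal.add_ne_top.2 ⟨hA', ENNReal.mul_ne_top
    (ENNReal.rpow_ne_top_of_ne_zero hX0 hX1) hT'⟩
  have hG : X ^ (-p) * A + T = X ^ (-p) * D := by
    rw [hD, mul_add, ← mul_assoc, ← ENNReal.rpow_add _ _ hX0 hX1]; simp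
  rw [hG, ENNReal.mul_rpow_of_ne_top (ENNReal.rpow_ne_top_of_ne_zero hX0 hX1) hD1,
    ← ENNReal.rpow_mul, div_eq_mul_inv, ← ENNReal.rpow_neg]
  have h1 : X ^ p * T * D ^ (-1 : ℝ) ≤ 1 := by
    rw [ENNReal.rpow_neg_one, ← div_eq_mul_inv]
    exact ENNReal.div_le_of_le_mul (by rw [one_mul, hD]; exact le_add_self)
  have h2 : (1 : ℝ≥0∞) ≤ ENNReal.ofReal p := by
    rw [← ENNReal.ofReal_one]; exact ENNReal.ofReal_le_ofReal hp.le
  calc X ^ (p + q - 1) * A * T * D ^ (-(q + 1))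
      = X ^ (-p - 1) * A * (X ^ (-p * -q) * D ^ (-q)) * (X ^ p * T * D ^ (-1 : ℝ)) := by
        rw [show p + q - 1 = (-p - 1) + (-p * -q) + p by rw [hpq]; ring,
          show -(q + 1) = -q + -1 by ring, ENNReal.rpow_add _ _ hX0 hX1,
          ENNReal.rpow_add _ _ hX0 hX1, ENNReal.rpow_add _ _ hD0 hD1]
        ring
    _ ≤ X ^ (-p - 1) * A * (X ^ (-p * -q) * D ^ (-q)) * 1 := by gcongr
    _ = 1 * (X ^ (-p - 1) * A * (X ^ (-p * -q) * D ^ (-q))) := by ring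
    _ ≤ ENNReal.ofReal p * (X ^ (-p - 1) * A * (X ^ (-p * -q) * D ^ (-q))) := by gcongr
    _ = _ := by ring

lemma psi_bd2 (p q x : ℝ) (hp : 1 < p) (hx : 0 < x)
    (A T : ℝ≥0∞) (hA : A ≠ 0) (hA' : A ≠ ⊤) (hT' : T ≠ ⊤) :
    ENNReal.ofReal (x ^ (p + q - 1)) * A * T / (A + ENNReal.ofReal (x ^ p) * T) ^ (q + 1)
      * ENNReal.ofReal (x ^ (-q)) ≤
      ENNReal.ofReal (p * x ^ (p - 1)) * T * (A + ENNReal.ofReal (x ^ p) * T) ^ (-q) := by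
  rw [ENNReal.ofReal_mul (by linarith)]
  simp only [← ENNReal.ofReal_rpow_of_pos hx]
  set X := ENNReal.ofReal x with hX
  have hX0 : X ≠ 0 := by simp [hX, hx]
  have hX1 : X ≠ ⊤ := by simp [hX]
  set D := A + X ^ p * T with hD
  have hD0 : D ≠ 0 := fun h => hA (by simpa using (add_eq_zero.1 h).1)
  have hD1 : D ≠ ⊤ := ENNReal.add_ne_top.2 ⟨hA', ENNReal.mul_ne_top
    (ENNReal.rpow_ne_top_of_ne_zero hX0 hX1) hT'⟩
  rw [div_eq_mul_inv, ← ENNReal.rpow_neg]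
  have h1 : A * D ^ (-1 : ℝ) ≤ 1 := by
    rw [ENNReal.rpow_neg_one, ← div_eq_mul_inv]
    exact ENNReal.div_le_of_le_mul (by rw [one_mul, hD]; exact le_self_add)
  have h2 : (1 : ℝ≥0∞) ≤ ENNReal.ofReal p := by
    rw [← ENNReal.ofReal_one]; exact ENNReal.ofReal_le_ofReal hp.le
  calc X ^ (p + q - 1) * A * T * D ^ (-(q + 1)) * X ^ (-q)
      = X ^ (p - 1) * T * D ^ (-q) * (A * D ^ (-1 : ℝ)) := by
        rw [show p - 1 = (p + q - 1) + -q by ring,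
          show -(q + 1) = -q + -1 by ring, ENNReal.rpow_add (p + q - 1) (-q) hX0 hX1,
          ENNReal.rpow_add _ _ hD0 hD1]
        ring
    _ ≤ X ^ (p - 1) * T * D ^ (-q) * 1 := by gcongr
    _ = 1 * (X ^ (p - 1) * T * D ^ (-q)) := by ring
    _ ≤ ENNReal.ofReal p * (X ^ (p - 1) * T * D ^ (-q)) := by gcongr
    _ = _ := by ring

lemma intPhi_pos {b : ℝ≥0∞} {φ : ℝ → ℝ≥0∞} (hφ : IsWeight b φ) {x : ℝ} (hx : x ∈ IbSet b) :
    intPhi φ x ≠ 0 := by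
  rw [← pos_iff_ne_zero, intPhi, setLIntegral_pos_iff hφ.1]
  refine lt_of_lt_of_le ?_ (measure_mono (s := Ioo 0 x) ?_)
  · simp [hx.1]
  · intro t ht
    exact ⟨(hφ.2.1 t (Ioo_sub_Ib hx ht)).1.ne', ht⟩

lemma tailP_pos {b : ℝ≥0∞} {p : ℝ} {φ : ℝ → ℝ≥0∞} (hφ : IsWeight b φ) {x : ℝ}
    (hx : x ∈ IbSet b) : tailP b p φ x ≠ 0 := by
  have hm := hφ.1
  rw [← pos_iff_ne_zero, tailP, setLIntegral_pos_iff (by fun_prop)]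
  obtain ⟨c, hc1, hc2⟩ := ENNReal.lt_iff_exists_real_btwn.1 hx.2
  have hxc : x < c := by
    by_contra hcon
    exact absurd hc2.1 (not_lt.2 (ENNReal.ofReal_le_ofReal (not_lt.1 hcon)))
  refine lt_of_lt_of_le ?_ (measure_mono (s := Ioo x c) ?_)
  · simp [hxc]
  · intro t ht
    have ht0 : 0 < t := hx.1.trans ht.1
    have htb : ENNReal.ofReal t < b :=
      lt_of_le_of_lt (ENNReal.ofReal_le_ofReal ht.2.le) hc2.2
    refine ⟨mul_ne_zero (hφ.2.1 t ⟨ht0, htb⟩).1.ne' ?_, ht.1, htb⟩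
    simp only [ne_eq, ENNReal.ofReal_eq_zero, not_le]
    positivity

lemma intPhi_fin {b : ℝ≥0∞} {φ : ℝ → ℝ≥0∞} (hφ : IsWeight b φ) {x y : ℝ} (hx : x ∈ IbSet b)
    (hy : y ∈ IbSet b) (h : intPhi φ x ≠ ⊤) : intPhi φ y ≠ ⊤ := by
  have : intPhi φ y ≤ intPhi φ x + ∫⁻ t in Icc x y, φ t := by
    refine le_trans (lintegral_mono_set ?_) (lintegral_union_le _ _ _)
    intro t ht
    rcases lt_or_ge t x with h' | h'
    · left; exact ⟨ht.1, h'⟩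
    · right; exact ⟨h', ht.2.le⟩
  exact ne_top_of_le_ne_top (ENNReal.add_ne_top.2 ⟨h, (hφ.2.2 x y hx.1 hy.2).ne⟩) this

lemma tailP_fin {b : ℝ≥0∞} {p : ℝ} (hp : 1 < p) {φ : ℝ → ℝ≥0∞} (hφ : IsWeight b φ) {x y : ℝ}
    (hx : x ∈ IbSet b) (hy : y ∈ IbSet b) (h : tailP b p φ x ≠ ⊤) : tailP b p φ y ≠ ⊤ := by
  have : tailP b p φ y ≤ tailP b p φ x +
      ∫⁻ t in Icc y x, φ t * ENNReal.ofReal (t ^ (-p)) := by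
    refine le_trans (lintegral_mono_set ?_) (lintegral_union_le _ _ _)
    intro t ht
    rcases lt_or_ge x t with h' | h'
    · left; exact ⟨h', ht.2⟩
    · right; exact ⟨ht.1.le, h'⟩
  have h2 : ∫⁻ t in Icc y x, φ t * ENNReal.ofReal (t ^ (-p)) ≤
      (∫⁻ t in Icc y x, φ t) * ENNReal.ofReal (y ^ (-p)) := by
    rw [← lintegral_mul_const' _ _ ENNReal.ofReal_ne_top]
    refine setLIntegral_mono' measurableSet_Icc fun t ht => ?_
    gcongr _ * ENNReal.ofReal ?_
    exact Real.rpow_le_rpow_of_nonpos hy.1 ht.1 (by linarith)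
  exact ne_top_of_le_ne_top (ENNReal.add_ne_top.2 ⟨h, ne_top_of_le_ne_top
    (ENNReal.mul_ne_top (hφ.2.2 y x hy.1 hx.2).ne ENNReal.ofReal_ne_top) h2⟩) this

lemma exp_id (p : ℝ) (hp : 1 < p) : -(p / (p - 1)) + 1 / (p * (p - 1)) = -(1 + 1 / p) := by
  have : p - 1 ≠ 0 := by linarith
  have : p ≠ 0 := by linarith
  field_simp; ring

/-- transfer of lemma B to the weight. -/
lemma hnu (lam : Measure ℝ) (p : ℝ) (hp : 1 < p) (C : ℝ≥0∞) (ψ ρ F : ℝ → ℝ≥0∞)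
    (hF : Measurable F) (hρ : Measurable ρ)
    (hFae : ∀ᵐ t ∂lam, F t ≠ 0 ∧ F t ≠ ⊤)
    (hbd : ∀ᵐ t ∂lam, ψ t ≤ ρ t * F t ^ (-(p / (p - 1))))
    (hB : ∀ y ≠ ⊤, y ≠ 0 → ∫⁻ x in {x | y ≤ F x}, F x ^ (-(1 + 1 / p)) ∂(lam.withDensity ρ) ≤
      C * y ^ (1 - (1 + 1 / p))) :
    ∀ y ≠ ⊤, y ≠ 0 → ∫⁻ s in {s | y ≤ F s}, ψ s * F s ^ (1 / (p * (p - 1))) ∂lam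
        ≤ C * y ^ (-(1 / p)) := by
  intro y hy hy0
  have h := hB y hy hy0
  rw [show 1 - (1 + 1 / p) = -(1 / p) by ring] at h
  refine le_trans ?_ h
  rw [restrict_withDensity (measurableSet_le measurable_const hF),
    lintegral_withDensity_eq_lintegral_mul _ hρ (by fun_prop)]
  refine lintegral_mono_ae (ae_restrict_of_ae ?_)
  filter_upwards [hFae, hbd] with t h1 h2
  calc ψ t * F t ^ (1 / (p * (p - 1))) ≤
        ρ t * F t ^ (-(p / (p - 1))) * F t ^ (1 / (p * (p - 1))) := by gcongr
    _ = _ := by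
      rw [mul_assoc, ← ENNReal.rpow_add _ _ h1.1 h1.2, exp_id p hp]
      rfl

theorem main_nondeg (p : ℝ) (hp : 1 < p) (b : ℝ≥0∞)
    (φ : ℝ → ℝ≥0∞) (hφ : IsWeight b φ)
    (hA : ∀ x ∈ IbSet b, intPhi φ x ≠ ⊤) (hT : ∀ x ∈ IbSet b, tailP b p φ x ≠ ⊤) :
    ∃ M : ℝ≥0∞, M ≠ ⊤ ∧ ∀ h : ℝ → ℝ≥0∞, Measurable h →
      ∫⁻ t in IbSet b, (Pavg h t + Qavg b h t) ^ p * φ t ≤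
        M * ∫⁻ t in IbSet b, h t ^ p * (dualWeight b p φ t) ^ (1 - p) := by
  have hp0 : 0 < p := by linarith
  have hp1 : 0 < p - 1 := by linarith
  have hφm := hφ.1
  have hA0 : ∀ x ∈ IbSet b, intPhi φ x ≠ 0 := fun x hx => intPhi_pos hφ hx
  have hT0 : ∀ x ∈ IbSet b, tailP b p φ x ≠ 0 := fun x hx => tailP_pos hφ hx
  obtain ⟨C1, hC1, H⟩ := hardy_abs p hp
  obtain ⟨C2, hC2, hB⟩ := lemB (1 + 1 / p) (by have : 0 < 1 / p := by positivity
                                               linarith)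
  set lam := volume.restrict (IbSet b) with hlam
  have hmem : ∀ᵐ t ∂lam, t ∈ IbSet b := ae_restrict_mem (meas_Ib b)
  set q := p / (p - 1) with hq
  have hpq : p + q = p * q := by rw [hq]; field_simp; ring
  have hF := (Fmax_anti b p hp φ).measurable
  have hE := (Emin_mono b p hp φ).measurable
  have hAm := (intPhi_mono φ).measurable
  have hTm := (tailP_anti b p φ).measurable
  have hψm := meas_dual b p φ
  have hpos : ∀ x ∈ IbSet b, ∀ r : ℝ, ENNReal.ofReal (x ^ r) ≠ 0 := by
    intro x hx r
    simp only [ne_eq, ENNReal.ofReal_eq_zero, not_le]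
    have := hx.1
    positivity
  have hFae : ∀ᵐ t ∂lam, Fmax b p φ t ≠ 0 ∧ Fmax b p φ t ≠ ⊤ := by
    filter_upwards [hmem] with t ht
    rw [Fmax_eq ht]
    exact ⟨fun h => hT0 t ht (add_eq_zero.1 h).2, ENNReal.add_ne_top.2
      ⟨ENNReal.mul_ne_top ENNReal.ofReal_ne_top (hA t ht), hT t ht⟩⟩
  have hD : ∀ t ∈ IbSet b, DPhi b p φ t ≠ 0 ∧ DPhi b p φ t ≠ ⊤ := by
    intro t ht
    exact ⟨fun h => hA0 t ht (add_eq_zero.1 h).1, ENNReal.add_ne_top.2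
      ⟨hA t ht, ENNReal.mul_ne_top ENNReal.ofReal_ne_top (hT t ht)⟩⟩
  have hEae : ∀ᵐ t ∂lam, Emin b p φ t ≠ 0 ∧ Emin b p φ t ≠ ⊤ := by
    filter_upwards [hmem] with t ht
    rw [Emin_eq ht]
    exact hD t ht
  have hψ0 : ∀ t ∈ IbSet b, dualWeight b p φ t ≠ 0 ∧ dualWeight b p φ t ≠ ⊤ := by
    intro t ht
    have hDt := hD t ht
    refine ⟨?_, ?_⟩
    · refine ENNReal.div_ne_zero.2 ⟨mul_ne_zero (mul_ne_zero (hpos t ht _) (hA0 t ht)) (hT0 t ht),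
        ENNReal.rpow_ne_top_of_ne_zero hDt.1 hDt.2⟩
    · refine ENNReal.div_ne_top (ENNReal.mul_ne_top (ENNReal.mul_ne_top ENNReal.ofReal_ne_top
        (hA t ht)) (hT t ht)) ?_
      exact (ENNReal.rpow_pos (pos_iff_ne_zero.2 hDt.1) hDt.2).ne'
  have HP := H lam (fun t => φ t * ENNReal.ofReal (t ^ (-p))) (dualWeight b p φ) (Fmax b p φ)
    {z | z.1 < z.2} C2 (by fun_prop) hψm hF (measurableSet_lt measurable_fst measurable_snd)
    (fun y => by
      have := nsc_wd b (fun t => φ t * ENNReal.ofReal (t ^ (-p)))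
      have h := level_Ioi _ _ (Fmax_wd b p φ) y
      rwa [withDensity_apply _ (measurableSet_le hF measurable_const)] at h)
    (hnu lam p hp C2 _ (fun y => ENNReal.ofReal (p * y ^ (-p - 1)) * intPhi φ y) _ hF
      (by fun_prop) hFae
      (by
        filter_upwards [hmem] with t ht
        rw [Fmax_eq ht]
        exact psi_bd1 p q t hp hpq ht.1 _ _ (hA0 t ht) (hA t ht) (hT t ht))
      (hB _ _ hF (by
        have := nsc_wd b (fun y => ENNReal.ofReal (p * y ^ (-p - 1)) * intPhi φ y)
        exact level_Ioi _ _ (Fmax_tonelli b p hp φ hφm))))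
    hFae (hmem.mono fun t ht => hψ0 t ht)
    (fun s t hst => Fmax_anti b p hp φ (le_of_lt hst))
  have HQ := H lam φ (fun t => dualWeight b p φ t * ENNReal.ofReal (t ^ (-q))) (Emin b p φ)
    {z | z.2 < z.1} C2 hφm (by fun_prop) hE (measurableSet_lt measurable_snd measurable_fst)
    (fun y => by
      have := nsc_wd b φ
      have h := level_Iio _ _ (Emin_wd b p φ) y
      rwa [withDensity_apply _ (measurableSet_le hE measurable_const)] at h)
    (hnu lam p hp C2 _ (fun y => ENNReal.ofReal (p * y ^ (p - 1)) * tailP b p φ y) _ hE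
      (by fun_prop) hEae
      (by
        filter_upwards [hmem] with t ht
        rw [Emin_eq ht]
        exact psi_bd2 p q t hp ht.1 _ _ (hA0 t ht) (hA t ht) (hT t ht))
      (hB _ _ hE (by
        have := nsc_wd b (fun y => ENNReal.ofReal (p * y ^ (p - 1)) * tailP b p φ y)
        exact level_Iio _ _ (Emin_tonelli b p hp φ hφm))))
    hEae (hmem.mono fun t ht => ⟨mul_ne_zero (hψ0 t ht).1 (hpos t ht _),
      ENNReal.mul_ne_top (hψ0 t ht).2 ENNReal.ofReal_ne_top⟩)
    (fun s t hst => Emin_mono b p hp φ (le_of_lt hst))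
  set M := C2 ^ (p - 1) * C1 with hM
  have hMt : M ≠ ⊤ := ENNReal.mul_ne_top (ENNReal.rpow_ne_top_of_nonneg hp1.le hC2) hC1
  refine ⟨2 ^ (p - 1) * (M + M), by finiteness, ?_⟩
  intro h hh
  set Z := ∫⁻ t, h t ^ p * (dualWeight b p φ t) ^ (1 - p) ∂lam with hZ
  have hPm : Measurable fun t => (Pavg h t) ^ p * φ t := by
    have : Measurable fun t : ℝ => ∫⁻ s in Ioo (0 : ℝ) t, h s := (intPhi_mono h).measurable
    unfold Pavg
    fun_prop
  have eP : ∫⁻ t, (Pavg h t) ^ p * φ t ∂lam ≤ M * Z := by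
    refine le_trans (le_of_eq ?_) (HP h hh)
    refine setLIntegral_congr_fun (meas_Ib b) fun t ht => ?_
    have e1 : ∫⁻ s, ({z : ℝ × ℝ | z.1 < z.2}).indicator (fun _ => 1) (s, t) * h s ∂lam =
        ∫⁻ s in Ioo 0 t, h s := by
      rw [head_eq ht, inter_comm, ← Measure.restrict_restrict measurableSet_Iio,
        ← lintegral_indicator measurableSet_Iio]
      refine lintegral_congr fun s => ?_
      by_cases hs : s < t <;> simp [hs]
    rw [e1, Pavg, ENNReal.mul_rpow_of_nonneg _ _ hp0.le, ← ENNReal.ofReal_rpow_of_pos ht.1,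
      ENNReal.inv_rpow, ← ENNReal.rpow_neg]
    ring
  have eQ : ∫⁻ t, (Qavg b h t) ^ p * φ t ∂lam ≤ M * Z := by
    have h2 := HQ (fun s => h s * (ENNReal.ofReal s)⁻¹) (by fun_prop)
    have e2 : ∫⁻ s, (h s * (ENNReal.ofReal s)⁻¹) ^ p *
        (dualWeight b p φ s * ENNReal.ofReal (s ^ (-q))) ^ (1 - p) ∂lam = Z := by
      refine setLIntegral_congr_fun (meas_Ib b) fun s hs => ?_
      have hX0 : ENNReal.ofReal s ≠ 0 := by simpa using hs.1
      rw [ENNReal.mul_rpow_of_nonneg _ _ hp0.le, ENNReal.mul_rpow_of_ne_top (hψ0 s hs).2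
        ENNReal.ofReal_ne_top, ← ENNReal.ofReal_rpow_of_pos hs.1, ← ENNReal.rpow_mul,
        ENNReal.inv_rpow, ← ENNReal.rpow_neg]
      have e3 : ENNReal.ofReal s ^ (-p) * ENNReal.ofReal s ^ (-q * (1 - p)) = 1 := by
        rw [← ENNReal.rpow_add _ _ hX0 ENNReal.ofReal_ne_top,
          show -p + -q * (1 - p) = 0 by linarith]
        simp
      calc _ = h s ^ p * dualWeight b p φ s ^ (1 - p) *
            (ENNReal.ofReal s ^ (-p) * ENNReal.ofReal s ^ (-q * (1 - p))) := by ring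
        _ = _ := by rw [e3, mul_one]
    rw [e2] at h2
    refine le_trans (le_of_eq ?_) h2
    refine setLIntegral_congr_fun (meas_Ib b) fun t ht => ?_
    have e1 : ∫⁻ s, ({z : ℝ × ℝ | z.2 < z.1}).indicator (fun _ => 1) (s, t) *
        (h s * (ENNReal.ofReal s)⁻¹) ∂lam = Qavg b h t := by
      rw [Qavg, tail_eq ht.1.le, inter_comm, ← Measure.restrict_restrict measurableSet_Ioi,
        ← lintegral_indicator measurableSet_Ioi]
      refine lintegral_congr fun s => ?_
      by_cases hs : t < s <;> simp [hs]
    rw [e1]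
  calc ∫⁻ t, (Pavg h t + Qavg b h t) ^ p * φ t ∂lam
      ≤ ∫⁻ t, 2 ^ (p - 1) * ((Pavg h t) ^ p * φ t + (Qavg b h t) ^ p * φ t) ∂lam := by
        refine lintegral_mono fun t => ?_
        calc _ ≤ (2 ^ (p - 1) * (Pavg h t ^ p + Qavg b h t ^ p)) * φ t := by
              gcongr; exact ENNReal.rpow_add_le_mul_rpow_add_rpow _ _ hp.le
          _ = _ := by ring
    _ = 2 ^ (p - 1) * (∫⁻ t, (Pavg h t) ^ p * φ t ∂lam + ∫⁻ t, (Qavg b h t) ^ p * φ t ∂lam) := by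
        rw [lintegral_const_mul' _ _ (by finiteness), lintegral_add_left hPm]
    _ ≤ 2 ^ (p - 1) * (M * Z + M * Z) := by gcongr
    _ = _ := by ring

theorem main_deg (p : ℝ) (hp : 1 < p) (b : ℝ≥0∞)
    (φ : ℝ → ℝ≥0∞)
    (hD : ∀ x ∈ IbSet b, DPhi b p φ x = ⊤) (h : ℝ → ℝ≥0∞) (hh : Measurable h) :
      ∫⁻ t in IbSet b, (Pavg h t + Qavg b h t) ^ p * φ t ≤
        1 * ∫⁻ t in IbSet b, h t ^ p * (dualWeight b p φ t) ^ (1 - p) := by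
  have hp0 : 0 < p := by linarith
  have hp1 : 0 < p - 1 := by linarith
  have hψ : ∀ x ∈ IbSet b, dualWeight b p φ x ^ (1 - p) = ⊤ := by
    intro x hx
    have : dualWeight b p φ x = 0 := by
      rw [dualWeight, hD x hx, ENNReal.top_rpow_of_pos (by positivity)]
      simp
    rw [this, ENNReal.zero_rpow_of_neg (by linarith)]
  rw [one_mul]
  by_cases hz : ∀ᵐ t ∂(volume.restrict (IbSet b)), h t = 0
  · refine le_trans (le_of_eq ?_) zero_le
    rw [← lintegral_zero (μ := volume.restrict (IbSet b))]
    refine setLIntegral_congr_fun (meas_Ib b) fun t ht => ?_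
    have h1 : Pavg h t = 0 := by
      rw [Pavg, head_eq ht, inter_comm, ← Measure.restrict_restrict measurableSet_Iio]
      rw [lintegral_congr_ae (g := fun _ => 0) (ae_restrict_of_ae hz)]; simp
    have h2 : Qavg b h t = 0 := by
      rw [Qavg, tail_eq ht.1.le, inter_comm, ← Measure.restrict_restrict measurableSet_Ioi]
      rw [lintegral_congr_ae (g := fun _ => 0) (ae_restrict_of_ae (hz.mono fun s hs => by
        simp [hs]))]; simp
    simp [h1, h2, hp0]
  · refine le_trans le_top (le_of_eq ?_)
    rw [eq_comm]
    by_contra hne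
    apply hz
    have hm := meas_dual b p φ
    have := ae_lt_top (by fun_prop) hne
    filter_upwards [this, ae_restrict_mem (meas_Ib b)] with t h1 ht
    rw [hψ t ht] at h1
    by_contra h0
    have : h t ^ p ≠ 0 := by simp [h0, hp0, hp0.le]
    rw [ENNReal.mul_top this] at h1
    exact lt_irrefl _ h1

theorem statement18 (p : ℝ) (hp : 1 < p) (b : ℝ≥0∞) (hb : 0 < b)
    (φ : ℝ → ℝ≥0∞) (hφ : IsNontrivialWeight b p φ) :
    ∃ B : ℝ, 0 < B ∧ ∀ h : ℝ → ℝ≥0∞, Measurable h →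
      (∫⁻ t in IbSet b, (Pavg h t + Qavg b h t) ^ p * φ t) ^ (1 / p) ≤
        ENNReal.ofReal B *
          (∫⁻ t in IbSet b, h t ^ p * (dualWeight b p φ t) ^ (1 - p)) ^ (1 / p) := by
  have hw := hφ.1
  have hp0 : 0 < p := by linarith
  have key : ∃ M : ℝ≥0∞, M ≠ ⊤ ∧ ∀ h : ℝ → ℝ≥0∞, Measurable h →
      ∫⁻ t in IbSet b, (Pavg h t + Qavg b h t) ^ p * φ t ≤
        M * ∫⁻ t in IbSet b, h t ^ p * (dualWeight b p φ t) ^ (1 - p) := by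
    by_cases hA : ∀ x ∈ IbSet b, intPhi φ x ≠ ⊤
    · by_cases hT : ∀ x ∈ IbSet b, tailP b p φ x ≠ ⊤
      · exact main_nondeg p hp b φ hw hA hT
      · push Not at hT
        obtain ⟨x, hx, hxT⟩ := hT
        refine ⟨1, by simp, main_deg p hp b φ fun y hy => ?_⟩
        have : tailP b p φ y = ⊤ := by
          by_contra hne
          exact tailP_fin hp hw hy hx hne hxT
        have hy0 : ENNReal.ofReal (y ^ p) ≠ 0 := by
          simp only [ne_eq, ENNReal.ofReal_eq_zero, not_le]
          have := hy.1
          positivity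
        rw [DPhi, this, ENNReal.mul_top hy0]; simp
    · push Not at hA
      obtain ⟨x, hx, hxA⟩ := hA
      refine ⟨1, by simp, main_deg p hp b φ fun y hy => ?_⟩
      have : intPhi φ y = ⊤ := by
        by_contra hne
        exact intPhi_fin hw hy hx hne hxA
      rw [DPhi, this]; simp
  obtain ⟨M, hM, hmain⟩ := key
  refine ⟨(M ^ (1 / p)).toReal + 1, by positivity, fun h hh => ?_⟩
  have hMp : M ^ (1 / p) ≠ ⊤ := ENNReal.rpow_ne_top_of_nonneg (by positivity) hM
  calc _ ≤ (M * ∫⁻ t in IbSet b, h t ^ p * (dualWeight b p φ t) ^ (1 - p)) ^ (1 / p) := by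
        gcongr; exact hmain h hh
    _ = M ^ (1 / p) * (∫⁻ t in IbSet b, h t ^ p * (dualWeight b p φ t) ^ (1 - p)) ^ (1 / p) :=
        ENNReal.mul_rpow_of_nonneg _ _ (by positivity)
    _ ≤ _ := by
        gcongr
        conv_lhs => rw [← ENNReal.ofReal_toReal hMp]
        exact ENNReal.ofReal_le_ofReal (by linarith)

end
end
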